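/- arXiv:math-ph/0103034 — 8 statements merged into one kernel-verified Lean document; each statement's English description precedes it below -/
import Mathlib

section
/- Let N ≥ 1, let σ be the cyclic shift automorphism of the free ℤ-module ℤ^(ZMod N) with standard basis (e_i)_{i ∈ ZMod N}, given by σ(e_i) = e_{i+1}, and let Θ be a real-valued ℤ-bilinear form on ℤ^(ZMod N). Then there exists a family θ : ZMod N → (real bilinear forms on ℤ^(ZMod N)) with θ_0 = 0, θ_1 = Θ, and satisfying θ_{a+b}(m,k) = θ_b(m,k) + θ_a(σ^b m, σ^b k) for all a,b ∈ ZMod N, if and only if for all i,j ∈ ZMod N one has Σ_{t=0}^{N−1} Θ(e_{i+t}, e_{j+t}) = 0. -/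
/-- The `b`-fold cyclic shift on `ℤ^(ZMod N)`, i.e. the `b`-th power of the cyclic shift
automorphism `σ` determined by `σ(e_i) = e_{i+1}` on the standard basis. -/
def cyclicShift (N : ℕ) (b : ZMod N) : (ZMod N → ℤ) →ₗ[ℤ] (ZMod N → ℤ) where
  toFun f := fun j => f (j - b)
  map_add' := by intros; rfl
  map_smul' := by intros; rfl

theorem cyclicShift_single (N : ℕ) (b i : ZMod N) :
    cyclicShift N b (Pi.single i 1) = Pi.single (i + b) 1 := by
  funext j
  show (Pi.single i (1 : ℤ) : ZMod N → ℤ) (j - b) = (Pi.single (i + b) (1 : ℤ) : ZMod N → ℤ) j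
  simp only [Pi.single_apply, sub_eq_iff_eq_add]

theorem cyclicShift_comp (N : ℕ) (a b : ZMod N) (m : ZMod N → ℤ) :
    cyclicShift N a (cyclicShift N b m) = cyclicShift N (b + a) m := by
  funext j
  show m (j - a - b) = m (j - (b + a))
  congr 1
  ring

theorem cyclicShift_zero' (N : ℕ) (m : ZMod N → ℤ) : cyclicShift N 0 m = m := by
  funext j
  show m (j - 0) = m j
  rw [sub_zero]

/-- Partial orbit sums. -/
noncomputable def orbS (N : ℕ) (Θ : (ZMod N → ℤ) →ₗ[ℤ] (ZMod N → ℤ) →ₗ[ℤ] ℝ) (n : ℕ) :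
    (ZMod N → ℤ) →ₗ[ℤ] (ZMod N → ℤ) →ₗ[ℤ] ℝ :=
  ∑ t ∈ Finset.range n, Θ.compl₁₂ (cyclicShift N (t : ZMod N)) (cyclicShift N (t : ZMod N))

theorem orbS_apply (N : ℕ) (Θ : (ZMod N → ℤ) →ₗ[ℤ] (ZMod N → ℤ) →ₗ[ℤ] ℝ) (n : ℕ)
    (m k : ZMod N → ℤ) : orbS N Θ n m k =
      ∑ t ∈ Finset.range n, Θ (cyclicShift N (t : ZMod N) m) (cyclicShift N (t : ZMod N) k) := by
  simp [orbS, LinearMap.sum_apply]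

theorem orbS_add (N : ℕ) (Θ : (ZMod N → ℤ) →ₗ[ℤ] (ZMod N → ℤ) →ₗ[ℤ] ℝ) (a b : ℕ)
    (m k : ZMod N → ℤ) : orbS N Θ (a + b) m k =
      orbS N Θ b m k + orbS N Θ a (cyclicShift N b m) (cyclicShift N b k) := by
  rw [add_comm a b]
  simp only [orbS_apply, Finset.sum_range_add, cyclicShift_comp, Nat.cast_add]

theorem orbS_mod (N : ℕ) (Θ : (ZMod N → ℤ) →ₗ[ℤ] (ZMod N → ℤ) →ₗ[ℤ] ℝ)
    (h : orbS N Θ N = 0) (n q : ℕ) : orbS N Θ (n + N * q) = orbS N Θ n := by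
  induction q with
  | zero => simp
  | succ q ih =>
    rw [← ih]
    refine LinearMap.ext fun m => LinearMap.ext fun k => ?_
    rw [Nat.mul_succ, ← add_assoc, add_comm _ N, orbS_add, h]
    simp

/-- There exists a family `θ` of real-valued `ℤ`-bilinear forms on `ℤ^(ZMod N)` with
`θ_0 = 0`, `θ_1 = Θ` and satisfying the cocycle condition
`θ_{a+b}(m,k) = θ_b(m,k) + θ_a(σ^b m, σ^b k)` for the cyclic shift action of `ZMod N`,
if and only if `Σ_{t=0}^{N−1} Θ(e_{i+t}, e_{j+t}) = 0` for all `i, j ∈ ZMod N`. -/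
theorem stmt4 (N : ℕ) (hN : 1 ≤ N)
    (Θ : (ZMod N → ℤ) →ₗ[ℤ] (ZMod N → ℤ) →ₗ[ℤ] ℝ) :
    (∃ θ : ZMod N → ((ZMod N → ℤ) →ₗ[ℤ] (ZMod N → ℤ) →ₗ[ℤ] ℝ),
        θ 0 = 0 ∧ θ 1 = Θ ∧
        ∀ a b : ZMod N, ∀ m k : ZMod N → ℤ,
          θ (a + b) m k = θ b m k + θ a (cyclicShift N b m) (cyclicShift N b k)) ↔
    (∀ i j : ZMod N,
        ∑ t ∈ Finset.range N,
          Θ (Pi.single (i + (t : ZMod N)) 1) (Pi.single (j + (t : ZMod N)) 1) = 0) := by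
  haveI : NeZero N := ⟨by omega⟩
  constructor
  · rintro ⟨θ, h0, h1, hc⟩ i j
    have key : ∀ n : ℕ, ∀ m k, θ (n : ZMod N) m k = orbS N Θ n m k := by
      intro n
      induction n with
      | zero => intro m k; simp [h0, orbS]
      | succ n ih =>
        intro m k
        rw [Nat.cast_succ, add_comm, hc, ih, h1, orbS_apply, orbS_apply, Finset.sum_range_succ]
    have := key N (Pi.single i 1) (Pi.single j 1)
    rw [ZMod.natCast_self, h0, orbS_apply] at this
    simp only [cyclicShift_single] at this
    rw [← this]
    simp
  · intro h
    have hS : orbS N Θ N = 0 := by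
      refine (Pi.basisFun ℤ (ZMod N)).ext fun i => (Pi.basisFun ℤ (ZMod N)).ext fun j => ?_
      rw [orbS_apply]
      simp only [Pi.basisFun_apply, cyclicShift_single]
      rw [h i j]
      simp
    have hm : ∀ n : ℕ, orbS N Θ (n % N) = orbS N Θ n := by
      intro n
      conv_rhs => rw [← Nat.mod_add_div n N]
      rw [orbS_mod N Θ hS]
    refine ⟨fun a => orbS N Θ a.val, ?_, ?_, ?_⟩
    · simp [orbS]
    · have h1 : (1 : ZMod N).val = 1 % N := by
        rw [← Nat.cast_one, ZMod.val_natCast]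
      simp only [h1, hm]
      refine LinearMap.ext fun m => LinearMap.ext fun k => ?_
      rw [orbS_apply]
      simp [cyclicShift_zero']
    · intro a b m k
      simp only [ZMod.val_add, hm]
      rw [orbS_add]
      simp
end

section
/- Let q ∈ ℂ be a primitive third root of unity and let (a,b) ∈ (ZMod 3)². Let A(a,b) be the quotient of the free ℂ-algebra on three generators u, v, w by the two-sided ideal generated by u³−1, v³−1, w³−1, uv − q^a·vu, uw − q^b·wu, and vw − q^(b−a)·wv. Then for natural numbers α, β, γ, the image of the monomial u^α v^β w^γ lies in the center of A(a,b) if and only if a·β + b·γ ≡ 0, −a·α + (b−a)·γ ≡ 0, and −b·α − (b−a)·β ≡ 0 (all modulo 3). -/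
open FreeAlgebra

/-- The relations of the algebra `A(a,b)`: `u³ = 1`, `v³ = 1`, `w³ = 1`,
`uv = q^a·vu`, `uw = q^b·wu`, `vw = q^(b−a)·wv`, where `u, v, w` are the three
generators of the free `ℂ`-algebra. -/
inductive Rel3 (q : ℂ) (a b : ZMod 3) :
    FreeAlgebra ℂ (Fin 3) → FreeAlgebra ℂ (Fin 3) → Prop
  | u : Rel3 q a b (ι ℂ (0 : Fin 3) ^ 3) 1
  | v : Rel3 q a b (ι ℂ (1 : Fin 3) ^ 3) 1
  | w : Rel3 q a b (ι ℂ (2 : Fin 3) ^ 3) 1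
  | uv : Rel3 q a b (ι ℂ (0 : Fin 3) * ι ℂ (1 : Fin 3))
      (q ^ a.val • (ι ℂ (1 : Fin 3) * ι ℂ (0 : Fin 3)))
  | uw : Rel3 q a b (ι ℂ (0 : Fin 3) * ι ℂ (2 : Fin 3))
      (q ^ b.val • (ι ℂ (2 : Fin 3) * ι ℂ (0 : Fin 3)))
  | vw : Rel3 q a b (ι ℂ (1 : Fin 3) * ι ℂ (2 : Fin 3))
      (q ^ (b - a).val • (ι ℂ (2 : Fin 3) * ι ℂ (1 : Fin 3)))

lemma chi_add {q : ℂ} (hq : q ^ 3 = 1) (c d : ZMod 3) :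
    q ^ (c + d).val = q ^ c.val * q ^ d.val := by
  rw [ZMod.val_add, ← pow_add]
  conv_rhs => rw [← Nat.div_add_mod (c.val + d.val) 3, pow_add, pow_mul, hq, one_pow, one_mul]

lemma chi_one {q : ℂ} (hq : IsPrimitiveRoot q 3) (c : ZMod 3) :
    q ^ c.val = 1 ↔ c = 0 := by
  rw [hq.pow_eq_one_iff_dvd]
  constructor
  · intro h
    have := Nat.eq_zero_of_dvd_of_lt h (ZMod.val_lt c)
    exact (ZMod.val_eq_zero c).1 this
  · rintro rfl; simp

/-- Quasi-commutation. -/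
def QC {A : Type*} [Ring A] [Algebra ℂ A] (q : ℂ) (x : A) (c : ZMod 3) (y : A) : Prop :=
  x * y = q ^ c.val • (y * x)

section
variable {A : Type*} [Ring A] [Algebra ℂ A] {q : ℂ}

lemma QC.mul (hq : q ^ 3 = 1) {x y z : A} {c d : ZMod 3} (h : QC q x c y) (h' : QC q x d z) :
    QC q x (c + d) (y * z) := by
  unfold QC at *
  rw [← mul_assoc, h, smul_mul_assoc, mul_assoc, h', chi_add hq, mul_smul, mul_smul_comm,
    mul_assoc]

lemma QC.pow (hq : q ^ 3 = 1) {x y : A} {c : ZMod 3} (h : QC q x c y) (n : ℕ) :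
    QC q x (c * n) (y ^ n) := by
  induction n with
  | zero => simp [QC]
  | succ n ih =>
    rw [pow_succ, Nat.cast_succ, mul_add, mul_one]
    exact ih.mul hq h

lemma QC.symm (hq : q ^ 3 = 1) {x y : A} {c : ZMod 3} (h : QC q x c y) :
    QC q y (-c) x := by
  unfold QC at *
  rw [h, smul_smul, ← chi_add hq]; simp

lemma QC.refl (x : A) : QC q x 0 x := by simp [QC]

lemma QC.comm_iff [Nontrivial A] (hq : IsPrimitiveRoot q 3) {x y : A} {c : ZMod 3}
    (h : QC q x c y) (hx : IsUnit x) (hy : IsUnit y) : x * y = y * x ↔ c = 0 := by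
  rw [← chi_one hq]
  unfold QC at h
  rw [h]
  constructor
  · intro h1
    have h2 : (q ^ c.val - 1) • (y * x) = 0 := by rw [sub_smul, h1, one_smul, sub_self]
    rcases smul_eq_zero.1 h2 with h3 | h3
    · exact sub_eq_zero.1 h3
    · exact absurd h3 (hy.mul hx).ne_zero
  · intro h1; rw [h1, one_smul]
end

/-- The representation space. -/
abbrev RepV := ZMod 3 × ZMod 3 → ℂ

/-- Weighted shifts. -/
def wshift (g : ZMod 3 × ZMod 3 → ℂ) (s : ZMod 3 × ZMod 3) : Module.End ℂ RepV where
  toFun f := fun p => g p * f (p + s)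
  map_add' f f' := by ext p; simp [mul_add]
  map_smul' r f := by ext p; simp; ring

/-- The generators' images. -/
def repGen (q : ℂ) (a b : ZMod 3) : Fin 3 → Module.End ℂ RepV :=
  ![wshift (fun _ => 1) (1, 0), wshift (fun p => q ^ (a * p.1).val) (0, 1),
    wshift (fun p => q ^ (b * p.1 + (b - a) * p.2).val) 0]

lemma rep_rel {q : ℂ} (hq : q ^ 3 = 1) (a b : ZMod 3) ⦃x y : FreeAlgebra ℂ (Fin 3)⦄
    (h : Rel3 q a b x y) :
    FreeAlgebra.lift ℂ (repGen q a b) x = FreeAlgebra.lift ℂ (repGen q a b) y := by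
  have h3 : (1 + 1 + 1 : ZMod 3) = 0 := by decide
  have hc : ∀ c : ZMod 3, q ^ c.val * (q ^ c.val * q ^ c.val) = 1 := by
    intro c
    calc _ = (q ^ 3) ^ c.val := by rw [← pow_mul]; ring
      _ = 1 := by rw [hq, one_pow]
  cases h <;> apply LinearMap.ext <;> intro f <;> funext ⟨s, t⟩ <;>
    simp [repGen, wshift, pow_succ, add_assoc]
  · rw [← add_assoc 1 1 1, h3, add_zero]
  · rw [← add_assoc 1 1 1, h3, add_zero, ← mul_assoc, ← mul_assoc, mul_assoc (q ^ _), hc, one_mul]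
  · rw [← mul_assoc, ← mul_assoc, mul_assoc (q ^ _), hc, one_mul]
  · rw [mul_add, chi_add hq, mul_one]; ring
  · rw [mul_add, mul_one, add_right_comm, chi_add hq]; ring
  · rw [mul_add, mul_one, ← add_assoc, chi_add hq _ (b - a)]; ring

lemma quot_nontrivial {q : ℂ} (hq : q ^ 3 = 1) (a b : ZMod 3) :
    Nontrivial (RingQuot (Rel3 q a b)) :=
  (RingQuot.liftAlgHom ℂ ⟨FreeAlgebra.lift ℂ (repGen q a b),
    rep_rel hq a b⟩).toRingHom.domain_nontrivial

/-- For `q` a primitive third root of unity, the image in `A(a,b)` of the monomial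
`u^α v^β w^γ` is central iff `a·β + b·γ = 0`, `−a·α + (b−a)·γ = 0` and
`−b·α − (b−a)·β = 0` in `ZMod 3`. -/
theorem stmt8 (q : ℂ) (hq : IsPrimitiveRoot q 3) (a b : ZMod 3) (α β γ : ℕ) :
    RingQuot.mkAlgHom ℂ (Rel3 q a b)
        (ι ℂ (0 : Fin 3) ^ α * ι ℂ (1 : Fin 3) ^ β * ι ℂ (2 : Fin 3) ^ γ) ∈
      Subalgebra.center ℂ (RingQuot (Rel3 q a b)) ↔
    (a * (β : ZMod 3) + b * (γ : ZMod 3) = 0 ∧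
     -a * (α : ZMod 3) + (b - a) * (γ : ZMod 3) = 0 ∧
     -b * (α : ZMod 3) - (b - a) * (β : ZMod 3) = 0) := by
  have hq3 := hq.pow_eq_one
  have := quot_nontrivial hq3 a b
  set π := RingQuot.mkAlgHom ℂ (Rel3 q a b) with hπ
  have rel : ∀ {x y}, Rel3 q a b x y → π x = π y := fun h => RingQuot.mkAlgHom_rel ℂ h
  set U := π (ι ℂ 0) with hU
  set V := π (ι ℂ 1) with hV
  set W := π (ι ℂ 2) with hW
  have hu : IsUnit U := IsUnit.of_pow_eq_one (by simpa using rel Rel3.u) three_ne_zero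
  have hv : IsUnit V := IsUnit.of_pow_eq_one (by simpa using rel Rel3.v) three_ne_zero
  have hw : IsUnit W := IsUnit.of_pow_eq_one (by simpa using rel Rel3.w) three_ne_zero
  have huv : QC q U a V := by simpa [QC] using rel Rel3.uv
  have huw : QC q U b W := by simpa [QC] using rel Rel3.uw
  have hvw : QC q V (b - a) W := by simpa [QC] using rel Rel3.vw
  have hM : π (ι ℂ 0 ^ α * ι ℂ 1 ^ β * ι ℂ 2 ^ γ) = U ^ α * V ^ β * W ^ γ := by simp [U, V, W]
  rw [hM]
  set M := U ^ α * V ^ β * W ^ γ with hMd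
  have hm : IsUnit M := ((hu.pow α).mul (hv.pow β)).mul (hw.pow γ)
  have h1 := ((((QC.refl U).pow hq3 α).mul hq3 (huv.pow hq3 β)).mul hq3
    (huw.pow hq3 γ)).comm_iff hq hu hm
  have h2 := ((((huv.symm hq3).pow hq3 α).mul hq3 ((QC.refl V).pow hq3 β)).mul hq3
    (hvw.pow hq3 γ)).comm_iff hq hv hm
  have h3 := ((((huw.symm hq3).pow hq3 α).mul hq3 ((hvw.symm hq3).pow hq3 β)).mul hq3
    ((QC.refl W).pow hq3 γ)).comm_iff hq hw hm
  rw [zero_mul, zero_add] at h1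
  rw [zero_mul, add_zero] at h2
  rw [zero_mul, add_zero, neg_mul (b - a), ← sub_eq_add_neg] at h3
  rw [← h1, ← h2, ← h3, Subalgebra.mem_center_iff]
  constructor
  · intro h
    exact ⟨h U, h V, h W⟩
  · rintro ⟨g1, g2, g3⟩ x
    obtain ⟨x, rfl⟩ := RingQuot.mkAlgHom_surjective ℂ (Rel3 q a b) x
    change Commute (π x) M
    induction x using FreeAlgebra.induction with
    | grade0 r => rw [AlgHom.commutes]; exact Algebra.commutes r M
    | grade1 i =>
      fin_cases i
      · exact g1
      · exact g2
      · exact g3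
    | mul x y hx hy => rw [map_mul]; exact hx.mul_left hy
    | add x y hx hy => rw [map_add]; exact hx.add_left hy
end

section
/- Let (a,b) ∈ (ZMod 2)² with (a,b) ≠ (0,0). Let A(a,b) be the quotient of the free ℂ-algebra on three generators u, v, w by the two-sided ideal generated by u²−1, v²−1, w²−1, uv − (−1)^a·vu, uw − (−1)^b·wu, and vw − (−1)^(b−a)·wv. Then A(a,b) is isomorphic as a ℂ-algebra to M₂(ℂ) × M₂(ℂ). -/
open FreeAlgebra

/-- The relations of the algebra `A(a,b)` for `N = 2`: `u² = 1`, `v² = 1`, `w² = 1`,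
`uv = (−1)^a·vu`, `uw = (−1)^b·wu`, `vw = (−1)^(b−a)·wv`, where `u, v, w` are the three
generators of the free `ℂ`-algebra. -/
inductive Rel2 (a b : ZMod 2) :
    FreeAlgebra ℂ (Fin 3) → FreeAlgebra ℂ (Fin 3) → Prop
  | u : Rel2 a b (ι ℂ (0 : Fin 3) ^ 2) 1
  | v : Rel2 a b (ι ℂ (1 : Fin 3) ^ 2) 1
  | w : Rel2 a b (ι ℂ (2 : Fin 3) ^ 2) 1
  | uv : Rel2 a b (ι ℂ (0 : Fin 3) * ι ℂ (1 : Fin 3))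
      ((-1 : ℂ) ^ a.val • (ι ℂ (1 : Fin 3) * ι ℂ (0 : Fin 3)))
  | uw : Rel2 a b (ι ℂ (0 : Fin 3) * ι ℂ (2 : Fin 3))
      ((-1 : ℂ) ^ b.val • (ι ℂ (2 : Fin 3) * ι ℂ (0 : Fin 3)))
  | vw : Rel2 a b (ι ℂ (1 : Fin 3) * ι ℂ (2 : Fin 3))
      ((-1 : ℂ) ^ (b - a).val • (ι ℂ (2 : Fin 3) * ι ℂ (1 : Fin 3)))

section helpers

abbrev MM := Matrix (Fin 2) (Fin 2) ℂ × Matrix (Fin 2) (Fin 2) ℂ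

noncomputable def PP : MM := (!![1, 0; 0, -1], !![1, 0; 0, -1])
noncomputable def QQ : MM := (!![1, 0; 0, -1], !![-1, 0; 0, 1])
noncomputable def RR : MM := (!![0, 1; 1, 0], !![0, 1; 1, 0])

lemma PP_sq : PP * PP = 1 := by
  ext i j <;> fin_cases i <;> fin_cases j <;> simp [PP]
lemma QQ_sq : QQ * QQ = 1 := by
  ext i j <;> fin_cases i <;> fin_cases j <;> simp [QQ]
lemma RR_sq : RR * RR = 1 := by
  ext i j <;> fin_cases i <;> fin_cases j <;> simp [RR]
lemma PQ : PP * QQ = QQ * PP := by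
  ext i j <;> fin_cases i <;> fin_cases j <;> simp [PP, QQ]
lemma PR : PP * RR = - (RR * PP) := by
  ext i j <;> fin_cases i <;> fin_cases j <;> simp [PP, RR]
lemma QR : QQ * RR = - (RR * QQ) := by
  ext i j <;> fin_cases i <;> fin_cases j <;> simp [QQ, RR]

noncomputable def psi {S : Type*} [Ring S] [Algebra ℂ S] (p q r : S) (m : MM) : S :=
  ((m.1 0 0 + m.1 1 1 + m.2 0 0 + m.2 1 1) / 4) • 1
  + ((m.1 0 0 - m.1 1 1 + m.2 0 0 - m.2 1 1) / 4) • p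
  + ((m.1 0 0 - m.1 1 1 - m.2 0 0 + m.2 1 1) / 4) • q
  + ((m.1 0 0 + m.1 1 1 - m.2 0 0 - m.2 1 1) / 4) • (p * q)
  + ((m.1 0 1 + m.1 1 0 + m.2 0 1 + m.2 1 0) / 4) • r
  + ((m.1 0 1 - m.1 1 0 + m.2 0 1 - m.2 1 0) / 4) • (p * r)
  + ((m.1 0 1 - m.1 1 0 - m.2 0 1 + m.2 1 0) / 4) • (q * r)
  + ((m.1 0 1 + m.1 1 0 - m.2 0 1 - m.2 1 0) / 4) • (p * (q * r))

lemma psi_MM (m : MM) : psi PP QQ RR m = m := by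
  ext i j <;> fin_cases i <;> fin_cases j <;>
    simp [psi, PP, QQ, RR] <;> ring

lemma key {S : Type*} [Ring S] [Algebra ℂ S] (p q r : S)
    (hp : p * p = 1) (hq : q * q = 1) (hr : r * r = 1)
    (hpq : p * q = q * p) (hpr : p * r = - (r * p)) (hqr : q * r = - (r * q))
    (hgen : Algebra.adjoin ℂ {p, q, r} = ⊤)
    (φ : S →ₐ[ℂ] MM) (h1 : φ p = PP) (h2 : φ q = QQ) (h3 : φ r = RR) :
    Nonempty (S ≃ₐ[ℂ] MM) := by
  have hqp := hpq.symm
  have hrp : r * p = - (p * r) := by rw [hpr, neg_neg]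
  have hrq : r * q = - (q * r) := by rw [hqr, neg_neg]
  have hp' : ∀ x, p * (p * x) = x := fun x => by rw [← mul_assoc, hp, one_mul]
  have hq' : ∀ x, q * (q * x) = x := fun x => by rw [← mul_assoc, hq, one_mul]
  have hqp' : ∀ x, q * (p * x) = p * (q * x) := fun x => by
    rw [← mul_assoc, hqp, mul_assoc]
  have hrp' : ∀ x, r * (p * x) = - (p * (r * x)) := fun x => by
    rw [← mul_assoc, hrp, neg_mul, mul_assoc]
  have hrq' : ∀ x, r * (q * x) = - (q * (r * x)) := fun x => by
    rw [← mul_assoc, hrq, neg_mul, mul_assoc]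
  clear hpq hpr hqr
  have hadd : ∀ m n, psi p q r (m + n) = psi p q r m + psi p q r n := by
    intro m n
    simp only [psi, Prod.fst_add, Prod.snd_add, Matrix.add_apply]
    module
  have hsm : ∀ (c : ℂ) m, psi p q r (c • m) = c • psi p q r m := by
    intro c m
    simp only [psi, Prod.smul_fst, Prod.smul_snd, Matrix.smul_apply, smul_eq_mul]
    module
  have hone : psi p q r 1 = 1 := by
    simp [psi]; norm_num
  have hall : ∀ x : S, ∀ m, x * psi p q r m = psi p q r (φ x * m) := by
    intro x
    have hx : x ∈ Algebra.adjoin ℂ {p, q, r} := by rw [hgen]; trivial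
    induction hx using Algebra.adjoin_induction with
    | mem x hx =>
      intro m
      rcases hx with rfl | rfl | rfl
      · rw [h1]
        simp only [psi, PP, mul_add, mul_smul_comm, hp, hp', mul_one, Prod.fst_mul, Prod.snd_mul,
          Matrix.mul_apply, Fin.sum_univ_two]
        simp
        module
      · rw [h2]
        simp only [psi, QQ, mul_add, mul_smul_comm, hq, hq', hqp, hqp', mul_one, Prod.fst_mul,
          Prod.snd_mul, Matrix.mul_apply, Fin.sum_univ_two]
        simp
        module
      · rw [h3]
        simp only [psi, RR, mul_add, mul_smul_comm, hr, hrp, hrp', hrq, hrq', mul_one, mul_neg,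
          neg_neg, Prod.fst_mul, Prod.snd_mul, Matrix.mul_apply, Fin.sum_univ_two]
        simp
        module
    | algebraMap c =>
      intro m
      rw [AlgHom.commutes, ← Algebra.smul_def, ← Algebra.smul_def, hsm]
    | add x y _ _ hx hy => intro m; rw [add_mul, hx, hy, map_add, add_mul, hadd]
    | mul x y _ _ hx hy => intro m; rw [mul_assoc, hy, hx, map_mul, mul_assoc]
  have hφψ : ∀ m, φ (psi p q r m) = m := by
    intro m
    conv_rhs => rw [← psi_MM m]
    simp only [psi, map_add, map_smul, map_mul, map_one, h1, h2, h3]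
  have hψφ : ∀ x, psi p q r (φ x) = x := by
    intro x
    have := hall x 1
    rw [hone, mul_one, mul_one] at this
    exact this.symm
  exact ⟨AlgEquiv.ofBijective φ
    ⟨Function.LeftInverse.injective hψφ, Function.RightInverse.surjective hφψ⟩⟩

lemma flip_neg {S : Type*} [Ring S] [Algebra ℂ S] (x y : S) (h : x = (-1 : ℂ) • y) :
    y = - x := by
  rw [h, neg_smul, one_smul, neg_neg]

lemma gen_top (a b : ZMod 2) :
    Algebra.adjoin ℂ (Set.range fun i => RingQuot.mkAlgHom ℂ (Rel2 a b) (ι ℂ i)) = ⊤ := by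
  have h : (Set.range fun i => RingQuot.mkAlgHom ℂ (Rel2 a b) (ι ℂ i))
      = RingQuot.mkAlgHom ℂ (Rel2 a b) '' Set.range (ι ℂ) := by
    rw [← Set.range_comp]; rfl
  rw [h, ← AlgHom.map_adjoin, FreeAlgebra.adjoin_range_ι, Algebra.map_top,
    AlgHom.range_eq_top]
  exact RingQuot.mkAlgHom_surjective ℂ _

lemma exists_hom (a b : ZMod 2) (f : Fin 3 → MM)
    (hu : f 0 * f 0 = 1) (hv : f 1 * f 1 = 1) (hw : f 2 * f 2 = 1)
    (huv : f 0 * f 1 = (-1 : ℂ) ^ a.val • (f 1 * f 0))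
    (huw : f 0 * f 2 = (-1 : ℂ) ^ b.val • (f 2 * f 0))
    (hvw : f 1 * f 2 = (-1 : ℂ) ^ (b - a).val • (f 2 * f 1)) :
    ∃ φ : RingQuot (Rel2 a b) →ₐ[ℂ] MM,
      ∀ i, φ (RingQuot.mkAlgHom ℂ (Rel2 a b) (ι ℂ i)) = f i := by
  refine ⟨RingQuot.liftAlgHom ℂ ⟨FreeAlgebra.lift ℂ f, ?_⟩, ?_⟩
  · intro x y h
    cases h <;> simp only [map_mul, map_smul, map_pow, map_one, FreeAlgebra.lift_ι_apply, pow_two]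
      <;> assumption
  · intro i
    rw [RingQuot.liftAlgHom_mkAlgHom_apply, FreeAlgebra.lift_ι_apply]

end helpers

/-- For `(a,b) ≠ (0,0)` in `(ZMod 2)²`, the algebra `A(a,b)` is isomorphic as a
`ℂ`-algebra to `M₂(ℂ) × M₂(ℂ)`. -/
theorem stmt9 (a b : ZMod 2) (hab : (a, b) ≠ (0, 0)) :
    Nonempty (RingQuot (Rel2 a b) ≃ₐ[ℂ]
      (Matrix (Fin 2) (Fin 2) ℂ × Matrix (Fin 2) (Fin 2) ℂ)) := by
  have hg := gen_top a b
  have e := exists_hom a b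
  have ru := RingQuot.mkAlgHom_rel ℂ (Rel2.u (a := a) (b := b))
  have rv := RingQuot.mkAlgHom_rel ℂ (Rel2.v (a := a) (b := b))
  have rw' := RingQuot.mkAlgHom_rel ℂ (Rel2.w (a := a) (b := b))
  have ruv := RingQuot.mkAlgHom_rel ℂ (Rel2.uv (a := a) (b := b))
  have ruw := RingQuot.mkAlgHom_rel ℂ (Rel2.uw (a := a) (b := b))
  have rvw := RingQuot.mkAlgHom_rel ℂ (Rel2.vw (a := a) (b := b))
  simp only [map_mul, map_smul, map_pow, map_one, pow_two] at ru rv rw' ruv ruw rvw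
  generalize hU : RingQuot.mkAlgHom ℂ (Rel2 a b) (ι ℂ 0) = U at *
  generalize hV : RingQuot.mkAlgHom ℂ (Rel2 a b) (ι ℂ 1) = V at *
  generalize hW : RingQuot.mkAlgHom ℂ (Rel2 a b) (ι ℂ 2) = W at *
  have hset : (Set.range fun i => RingQuot.mkAlgHom ℂ (Rel2 a b) (ι ℂ i)) = {U, V, W} := by
    ext x
    simp only [Set.mem_range, Fin.exists_fin_succ, Set.mem_insert_iff, Set.mem_singleton_iff]
    simp [hU, hV, hW, eq_comm]
  rw [hset] at hg
  have v0 : (0 : ZMod 2).val = 0 := rfl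
  have v1 : (1 : ZMod 2).val = 1 := rfl
  have s1 : (0 - 1 : ZMod 2) = 1 := rfl
  have hRP := PR
  have hRQ := QR
  have cases2 : ∀ x : ZMod 2, x = 0 ∨ x = 1 := by decide
  rcases cases2 a with rfl | rfl <;> rcases cases2 b with rfl | rfl
  · exact absurd rfl hab
  · simp only [sub_zero, v0, v1, pow_zero, pow_one, one_smul, neg_smul] at *
    obtain ⟨φ, hφ⟩ := e ![PP, QQ, RR] PP_sq QQ_sq RR_sq PQ PR QR
    refine key U V W ru rv rw' ruv ruw rvw hg φ ?_ ?_ ?_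
    · rw [← hU, hφ]; rfl
    · rw [← hV, hφ]; rfl
    · rw [← hW, hφ]; rfl
  · simp only [s1, v0, v1, pow_zero, pow_one, one_smul, neg_smul] at *
    obtain ⟨φ, hφ⟩ := e ![PP, RR, QQ] PP_sq RR_sq QQ_sq PR PQ
      (by simp [QR])
    refine key U W V ru rw' rv ruw ruv (flip_neg _ _ rvw) ?_ φ ?_ ?_ ?_
    · rw [← hg]; congr 1; ext x; simp; tauto
    · rw [← hU, hφ]; rfl
    · rw [← hW, hφ]; rfl
    · rw [← hV, hφ]; rfl
  · simp only [sub_self, v0, v1, pow_zero, pow_one, one_smul, neg_smul] at *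
    obtain ⟨φ, hφ⟩ := e ![RR, PP, QQ] RR_sq PP_sq QQ_sq (by simp [PR]) (by simp [QR]) PQ
    refine key V W U rv rw' ru rvw (flip_neg _ _ ruv) (flip_neg _ _ ruw) ?_ φ ?_ ?_ ?_
    · rw [← hg]; congr 1; ext x; simp; tauto
    · rw [← hV, hφ]; rfl
    · rw [← hW, hφ]; rfl
    · rw [← hU, hφ]; rfl
end

section
/- Let q ∈ ℂ be a primitive third root of unity and let (a,b) ∈ (ZMod 3)² with (a,b) ≠ (0,0). Let A(a,b) be the quotient of the free ℂ-algebra on three generators u, v, w by the two-sided ideal generated by u³−1, v³−1, w³−1, uv − q^a·vu, uw − q^b·wu, and vw − q^(b−a)·wv. Then the center of A(a,b) is 3-dimensional over ℂ, and A(a,b) is isomorphic as a ℂ-algebra to M₃(ℂ) × M₃(ℂ) × M₃(ℂ). -/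
open FreeAlgebra

abbrev M3 := Matrix (Fin 3) (Fin 3) ℂ
abbrev B3 := M3 × M3 × M3

def Cm (q : ℂ) : M3 := !![1,0,0;0,q,0;0,0,q^2]
def Dm : M3 := !![0,0,1;1,0,0;0,1,0]

lemma Cm_sq (q : ℂ) : Cm q ^ 2 = !![1,0,0;0,q^2,0;0,0,q^4] := by
  rw [pow_two]; ext i j; fin_cases i <;> fin_cases j <;> simp [Cm, Matrix.mul_apply, Fin.sum_univ_three] <;> ring

lemma Dm_sq : Dm ^ 2 = !![0,1,0;0,0,1;1,0,0] := by
  rw [pow_two]; ext i j; fin_cases i <;> fin_cases j <;> simp [Dm, Matrix.mul_apply, Fin.sum_univ_three]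

lemma Cm_cube (q : ℂ) (h : q ^ 3 = 1) : Cm q ^ 3 = 1 := by
  have h6 : q ^ 4 * q ^ 2 = 1 := by linear_combination (q^3+1) * h
  have h3 : q ^ 2 * q = 1 := by linear_combination h
  rw [pow_succ, Cm_sq]; ext i j
  fin_cases i <;> fin_cases j <;> simp [Cm, Matrix.mul_apply, Fin.sum_univ_three, h6, h3]

lemma Dm_cube : Dm ^ 3 = 1 := by
  rw [pow_succ, Dm_sq]; ext i j
  fin_cases i <;> fin_cases j <;> simp [Dm, Matrix.mul_apply, Fin.sum_univ_three]

lemma CD (q : ℂ) (h : q ^ 3 = 1) : Cm q * Dm = q • (Dm * Cm q) := by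
  ext i j
  fin_cases i <;> fin_cases j <;> simp [Cm, Dm, Matrix.mul_apply, Fin.sum_univ_three] <;>
    first | linear_combination -h | linear_combination (0:ℂ) * h

lemma top_of_CD (q : ℂ) (h : q ^ 3 = 1) (hs : 1 + q + q ^ 2 = 0) (S : Subalgebra ℂ M3)
    (hC : Cm q ∈ S) (hD : Dm ∈ S) (M : M3) : M ∈ S := by
  have h4 : q ^ 4 = q := by linear_combination q * h
  have hC2 : Cm q ^ 2 ∈ S := S.pow_mem hC 2
  have hD2 : Dm ^ 2 ∈ S := S.pow_mem hD 2
  have diag : ∀ x y z : ℂ, !![x,0,0;0,y,0;0,0,z] ∈ S := by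
    intro x y z
    have : !![x,0,0;0,y,0;0,0,z] = ((x+y+z)/3) • (1 : M3) + ((x+q^2*y+q*z)/3) • Cm q
        + ((x+q*y+q^2*z)/3) • Cm q ^ 2 := by
      rw [Cm_sq, Cm]
      ext i j
      fin_cases i <;> fin_cases j <;> simp
      · linear_combination -(y + z)/3 * hs
      · linear_combination (-(2*y)/3 + - z/3 * q) * h - x/3 * hs - z/3*hs
      · linear_combination (-x/3*q - y/3*(q+q^2) - z/3*(q^3+2)) * h - (x+y)/3 * hs
    rw [this]
    exact S.add_mem (S.add_mem (S.smul_mem S.one_mem _) (S.smul_mem hC _)) (S.smul_mem hC2 _)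
  have : M = !![M 0 0,0,0;0,M 1 1,0;0,0,M 2 2] + !![M 0 2,0,0;0,M 1 0,0;0,0,M 2 1] * Dm
      + !![M 0 1,0,0;0,M 1 2,0;0,0,M 2 0] * Dm ^ 2 := by
    rw [Dm_sq, Dm]
    ext i j
    fin_cases i <;> fin_cases j <;> simp [Matrix.mul_apply, Fin.sum_univ_three]
  rw [this]
  exact S.add_mem (S.add_mem (diag _ _ _) (S.mul_mem (diag _ _ _) hD)) (S.mul_mem (diag _ _ _) hD2)

def dg : M3 →ₐ[ℂ] B3 := (AlgHom.id ℂ M3).prod ((AlgHom.id ℂ M3).prod (AlgHom.id ℂ M3))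

def Zb (q : ℂ) : B3 := (1, q • 1, q ^ 2 • 1)

lemma top_of_CDZ (q : ℂ) (h : q ^ 3 = 1) (hs : 1 + q + q ^ 2 = 0) (S : Subalgebra ℂ B3)
    (hC : dg (Cm q) ∈ S) (hD : dg Dm ∈ S) (hZ : Zb q ∈ S) : S = ⊤ := by
  rw [eq_top_iff]
  rintro ⟨M, N, P⟩ -
  have hdg : ∀ M, dg M ∈ S := fun M => top_of_CD q h hs (S.comap dg) hC hD M
  have hZ2 : Zb q ^ 2 ∈ S := S.pow_mem hZ 2
  have : ((M, N, P) : B3) = dg ((1/3 : ℂ) • (M + N + P)) + Zb q * dg ((1/3 : ℂ) • (M + q^2 • N + q • P))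
      + Zb q ^ 2 * dg ((1/3 : ℂ) • (M + q • N + q^2 • P)) := by
    simp only [Zb, dg, pow_two (_ : B3)]
    refine Prod.ext ?_ (Prod.ext ?_ ?_)
    · ext i j; simp; linear_combination -(N i j + P i j)/3 * hs
    · ext i j
      simp
      linear_combination (-(2*N i j)/3 + - P i j/3 * q) * h - M i j/3 * hs - P i j/3*hs
    · ext i j
      simp
      linear_combination (-M i j/3*q - N i j/3*(q+q^2) - P i j/3*(q^3+2)) * h - (M i j+N i j)/3 * hs
  rw [this]
  exact S.add_mem (S.add_mem (hdg _) (S.mul_mem hZ (hdg _))) (S.mul_mem hZ2 (hdg _))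

section comm
variable {A : Type*} [Ring A] [Algebra ℂ A]

lemma qcomm_right {x y : A} {c : ℂ} (h : x * y = c • (y * x)) (n : ℕ) :
    x * y ^ n = c ^ n • (y ^ n * x) := by
  induction n with
  | zero => simp
  | succ n ih =>
    rw [pow_succ, ← mul_assoc, ih, smul_mul_assoc, mul_assoc, h, mul_smul_comm, smul_smul,
      ← mul_assoc, ← pow_succ]

lemma qcomm_left {x y : A} {c : ℂ} (h : x * y = c • (y * x)) (n : ℕ) :
    x ^ n * y = c ^ n • (y * x ^ n) := by
  induction n with
  | zero => simp
  | succ n ih =>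
    rw [pow_succ, mul_assoc, h, mul_smul_comm, ← mul_assoc, ih, smul_mul_assoc, smul_smul,
      mul_assoc, ← pow_succ, ← pow_succ']

lemma qcomm {x y : A} {c : ℂ} (h : x * y = c • (y * x)) (m n : ℕ) :
    x ^ m * y ^ n = c ^ (m * n) • (y ^ n * x ^ m) := by
  rw [qcomm_right (qcomm_left h m) n, pow_mul]

lemma qcomm_cube {x y : A} {c : ℂ} (hc : c ^ 3 = 1) (h : x * y = c • (y * x))
    (hx : x ^ 3 = 1) (hy : y ^ 3 = 1) : (y * x) ^ 3 = 1 := by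
  have h2 := qcomm_right h 2
  have e : (y * x) ^ 3 = y * (x * y) * (x * y) * x := by simp only [pow_succ, pow_zero, one_mul, mul_assoc]
  have e1 : y * (y * x) * (y * x) * x = y * y * (x * y) * x * x := by simp only [mul_assoc]
  have e2 : y * y * (y * x) * x * x = y ^ 3 * x ^ 3 := by
    simp only [pow_succ, pow_zero, one_mul, mul_assoc]
  rw [e, h]
  simp only [mul_smul_comm, smul_mul_assoc, smul_smul]
  rw [e1, h]
  simp only [mul_smul_comm, smul_mul_assoc, smul_smul]
  rw [e2, hx, hy, mul_one, show c * c * c = 1 by rw [← hc]; ring, one_smul]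

/-- span bound -/
lemma span_mono {u v w : A} {α β γ : ℂ} (hα : α ≠ 0) (hβ : β ≠ 0) (hγ : γ ≠ 0)
    (hu : u ^ 3 = 1) (hv : v ^ 3 = 1) (hw : w ^ 3 = 1)
    (huv : u * v = α • (v * u)) (huw : u * w = β • (w * u)) (hvw : v * w = γ • (w * v))
    (hgen : Algebra.adjoin ℂ {u, v, w} = ⊤) :
    Submodule.span ℂ (Set.range fun t : Fin 3 × Fin 3 × Fin 3 =>
      u ^ t.1.val * v ^ t.2.1.val * w ^ t.2.2.val) = ⊤ := by
  set V := Submodule.span ℂ (Set.range fun t : Fin 3 × Fin 3 × Fin 3 =>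
      u ^ t.1.val * v ^ t.2.1.val * w ^ t.2.2.val) with hV
  have red : ∀ {x : A}, x ^ 3 = 1 → ∀ n : ℕ, x ^ n = x ^ (n % 3) := by
    intro x hx n
    conv_lhs => rw [← Nat.mod_add_div n 3, pow_add, pow_mul, hx, one_pow, mul_one]
  have mem : ∀ i j k : ℕ, u ^ i * v ^ j * w ^ k ∈ V := by
    intro i j k
    rw [red hu i, red hv j, red hw k]
    exact Submodule.subset_span ⟨(⟨i % 3, Nat.mod_lt _ (by norm_num)⟩,
      ⟨j % 3, Nat.mod_lt _ (by norm_num)⟩, ⟨k % 3, Nat.mod_lt _ (by norm_num)⟩), rfl⟩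
  have huv' : v * u = α⁻¹ • (u * v) := by rw [huv, smul_smul, inv_mul_cancel₀ hα, one_smul]
  have huw' : w * u = β⁻¹ • (u * w) := by rw [huw, smul_smul, inv_mul_cancel₀ hβ, one_smul]
  have hvw' : w * v = γ⁻¹ • (v * w) := by rw [hvw, smul_smul, inv_mul_cancel₀ hγ, one_smul]
  have lift : ∀ g : A, (∀ i j k : ℕ, g * (u ^ i * v ^ j * w ^ k) ∈ V) → ∀ x ∈ V, g * x ∈ V := by
    intro g hg x hx
    induction hx using Submodule.span_induction with
    | mem x h => obtain ⟨t, rfl⟩ := h; exact hg _ _ _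
    | zero => simp
    | add x y _ _ hx hy => rw [mul_add]; exact V.add_mem hx hy
    | smul c x _ hx => rw [mul_smul_comm]; exact V.smul_mem _ hx
  have Lu := lift u (fun i j k => by
    have := mem (i + 1) j k
    rwa [pow_succ', mul_assoc, mul_assoc, ← mul_assoc (u ^ i)] at this)
  have Lv := lift v (fun i j k => by
    have : v * (u ^ i * v ^ j * w ^ k) = (α⁻¹ ^ i) • (u ^ i * v ^ (j + 1) * w ^ k) := by
      rw [← mul_assoc, ← mul_assoc, qcomm_right huv' i, pow_succ']
      simp only [smul_mul_assoc, mul_assoc]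
    rw [this]; exact V.smul_mem _ (mem _ _ _))
  have Lw := lift w (fun i j k => by
    have : w * (u ^ i * v ^ j * w ^ k) = (β⁻¹ ^ i * γ⁻¹ ^ j) • (u ^ i * v ^ j * w ^ (k + 1)) := by
      rw [← mul_assoc, ← mul_assoc, qcomm_right huw' i, pow_succ', smul_mul_assoc, mul_assoc (u ^ i),
        qcomm_right hvw' j]
      simp only [smul_mul_assoc, mul_smul_comm, smul_smul, mul_assoc]
    rw [this]; exact V.smul_mem _ (mem _ _ _))
  have key : ∀ g ∈ Algebra.adjoin ℂ {u, v, w}, ∀ x ∈ V, g * x ∈ V := by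
    intro g hg
    induction hg using Algebra.adjoin_induction with
    | mem g h =>
      rcases h with rfl | rfl | rfl
      · exact Lu
      · exact Lv
      · exact Lw
    | algebraMap r => intro x hx; rw [← Algebra.smul_def]; exact V.smul_mem _ hx
    | add a b _ _ ha hb => intro x hx; rw [add_mul]; exact V.add_mem (ha x hx) (hb x hx)
    | mul a b _ _ ha hb => intro x hx; rw [mul_assoc]; exact ha _ (hb _ hx)
  rw [eq_top_iff]
  rintro x -
  have h1 : (1 : A) ∈ V := by simpa using mem 0 0 0
  simpa using key x (hgen ▸ Algebra.mem_top) 1 h1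

end comm

/-- images of the generators -/
lemma exists_gens (q : ℂ) (hq : IsPrimitiveRoot q 3) (a b : ZMod 3) (hab : (a, b) ≠ (0, 0)) :
    ∃ u v w : B3, u ^ 3 = 1 ∧ v ^ 3 = 1 ∧ w ^ 3 = 1 ∧ u * v = q ^ a.val • (v * u) ∧
      u * w = q ^ b.val • (w * u) ∧ v * w = q ^ (b - a).val • (w * v) ∧
      Algebra.adjoin ℂ {u, v, w} = ⊤ := by
  have h3 : q ^ 3 = 1 := hq.pow_eq_one
  have hs : 1 + q + q ^ 2 = 0 := by
    have := hq.geom_sum_eq_zero (by norm_num)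
    simpa [Finset.sum_range_succ] using this
  obtain ⟨C, hC⟩ : ∃ C, C = dg (Cm q) := ⟨_, rfl⟩
  obtain ⟨D, hD⟩ : ∃ D, D = dg Dm := ⟨_, rfl⟩
  obtain ⟨Z, hZ⟩ : ∃ Z, Z = Zb q := ⟨_, rfl⟩
  have C3 : C ^ 3 = 1 := by rw [hC, ← map_pow, Cm_cube q h3, map_one]
  have D3 : D ^ 3 = 1 := by rw [hD, ← map_pow, Dm_cube, map_one]
  have Z3 : Z ^ 3 = 1 := by
    rw [hZ, Zb]
    simp only [Prod.pow_mk, smul_pow, one_pow, h3, ← pow_mul, mul_comm 2 3, one_smul]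
    rw [pow_mul, h3, one_pow, one_smul]; rfl
  have hCD : C * D = q • (D * C) := by
    rw [hC, hD, ← map_mul, ← map_mul, CD q h3, map_smul]
  have ZX : ∀ X : B3, Commute Z X := by
    rintro ⟨X, Y, W⟩
    rw [hZ, Zb]; simp [Commute, SemiconjBy]
  have top : ∀ S : Subalgebra ℂ B3, C ∈ S → D ∈ S → Z ∈ S → S = ⊤ := by
    intro S h1 h2 h4
    exact top_of_CDZ q h3 hs S (hC ▸ h1) (hD ▸ h2) (hZ ▸ h4)
  clear hC hD hZ
  have red : ∀ n : ℕ, q ^ n = q ^ (n % 3) := by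
    intro n
    conv_lhs => rw [← Nat.mod_add_div n 3, pow_add, pow_mul, h3, one_pow, mul_one]
  by_cases ha : a = 0
  · subst ha
    have hb : b ≠ 0 := by rintro rfl; exact hab rfl
    refine ⟨C, Z * C, D ^ b.val, C3, ?_, ?_, ?_, ?_, ?_, ?_⟩
    · rw [(ZX C).mul_pow, Z3, C3, one_mul]
    · rw [← pow_mul, mul_comm, pow_mul, D3, one_pow]
    · rw [ZMod.val_zero, pow_zero, one_smul, ← mul_assoc, (ZX C).eq]
    · exact qcomm_right hCD _
    · rw [sub_zero, mul_assoc, qcomm_right hCD, mul_smul_comm, ← mul_assoc, ← mul_assoc,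
        (ZX (D ^ b.val)).eq]
    · set S := Algebra.adjoin ℂ {C, Z * C, D ^ b.val}
      have m1 : C ∈ S := Algebra.subset_adjoin (by simp)
      have m2 : Z * C ∈ S := Algebra.subset_adjoin (by simp)
      have m3 : D ^ b.val ∈ S := Algebra.subset_adjoin (by simp)
      apply top S m1
      · have := S.pow_mem m3 b.val
        have e : (D ^ b.val) ^ b.val = D := by
          rw [← pow_mul]
          have : b.val * b.val = 1 ∨ b.val * b.val = 4 := by
            revert hb; clear * -; revert b; decide
          rcases this with h | h <;> rw [h]
          · simp
          · rw [pow_succ, D3, one_mul]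
        rwa [e] at this
      · have := S.mul_mem m2 (S.pow_mem m1 2)
        rwa [mul_assoc, ← pow_succ', C3, mul_one] at this
  · obtain ⟨i, hi⟩ : ∃ i : ℕ, i = (1 - b * a).val := ⟨_, rfl⟩
    have hPc : (D ^ b.val * C ^ i) ^ 3 = 1 := by
      apply qcomm_cube (c := q ^ (i * b.val)) _ (qcomm hCD _ _)
      · rw [← pow_mul, mul_comm, pow_mul, C3, one_pow]
      · rw [← pow_mul, mul_comm, pow_mul, D3, one_pow]
      · rw [← pow_mul, mul_comm, pow_mul, h3, one_pow]
    refine ⟨C, D ^ a.val, Z * (D ^ b.val * C ^ i), C3, ?_, ?_, ?_, ?_, ?_, ?_⟩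
    · rw [← pow_mul, mul_comm, pow_mul, D3, one_pow]
    · rw [(ZX _).mul_pow, Z3, hPc, one_mul]
    · exact qcomm_right hCD _
    · rw [← mul_assoc, ← (ZX C).eq, mul_assoc, ← mul_assoc C, qcomm_right hCD, smul_mul_assoc,
        mul_smul_comm, mul_assoc, mul_assoc, mul_assoc, ← pow_succ, ← pow_succ']
    · have e : D ^ b.val * C ^ i * D ^ a.val = q ^ (i * a.val) • (D ^ a.val * (D ^ b.val * C ^ i)) := by
        rw [mul_assoc, qcomm hCD, mul_smul_comm, ← mul_assoc, ← mul_assoc, ← pow_add, ← pow_add,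
          add_comm]
      have e2 : q ^ ((b - a).val) * q ^ (i * a.val) = 1 := by
        rw [← pow_add, red]
        have : ((b - a).val + i * a.val) % 3 = 0 := by
          subst hi; revert ha; clear * -; revert a b; decide
        rw [this, pow_zero]
      rw [mul_assoc Z, e, mul_smul_comm, smul_smul, e2, one_smul, ← mul_assoc, ← (ZX _).eq, mul_assoc]
    · set S := Algebra.adjoin ℂ {C, D ^ a.val, Z * (D ^ b.val * C ^ i)}
      have m1 : C ∈ S := Algebra.subset_adjoin (by simp)
      have m2 : D ^ a.val ∈ S := Algebra.subset_adjoin (by simp)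
      have m3 : Z * (D ^ b.val * C ^ i) ∈ S := Algebra.subset_adjoin (by simp)
      have mD : D ∈ S := by
        have := S.pow_mem m2 a.val
        have e : (D ^ a.val) ^ a.val = D := by
          rw [← pow_mul]
          have : a.val * a.val = 1 ∨ a.val * a.val = 4 := by
            revert ha; clear * -; revert a; decide
          rcases this with h | h <;> rw [h]
          · simp
          · rw [pow_succ, D3, one_mul]
        rwa [e] at this
      apply top S m1 mD
      have := S.mul_mem m3 (S.pow_mem (S.mul_mem (S.pow_mem mD b.val) (S.pow_mem m1 i)) 2)
      rwa [mul_assoc, ← pow_succ', hPc, mul_one] at this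

lemma center_fr {A : Type*} [Ring A] [Algebra ℂ A] (e : A ≃ₐ[ℂ] B3) :
    Module.finrank ℂ (Subalgebra.center ℂ A) = 3 := by
  let L : (ℂ × ℂ × ℂ) →ₗ[ℂ] B3 := (Algebra.linearMap ℂ M3).prodMap
    ((Algebra.linearMap ℂ M3).prodMap (Algebra.linearMap ℂ M3))
  have hL : Function.Injective (e.symm.toLinearMap ∘ₗ L) := by
    apply e.symm.injective.comp
    have hi := FaithfulSMul.algebraMap_injective ℂ M3
    exact hi.prodMap (hi.prodMap hi)
  have hr : LinearMap.range (e.symm.toLinearMap ∘ₗ L) = (Subalgebra.center ℂ A).toSubmodule := by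
    have hB : ∀ y : B3, y ∈ Subalgebra.center ℂ B3 ↔ y ∈ LinearMap.range L := by
      rintro ⟨x, y, z⟩
      rw [Subalgebra.center_prod, Subalgebra.center_prod, Algebra.IsCentral.center_eq_bot]
      simp only [Subalgebra.mem_prod, Algebra.mem_bot, LinearMap.mem_range, Set.mem_range]
      constructor
      · rintro ⟨⟨x, rfl⟩, ⟨y, rfl⟩, ⟨z, rfl⟩⟩
        exact ⟨(x, y, z), rfl⟩
      · rintro ⟨⟨x, y, z⟩, h⟩
        simp only [L, LinearMap.prodMap_apply, Prod.mk.injEq] at h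
        exact ⟨⟨x, h.1⟩, ⟨y, h.2.1⟩, ⟨z, h.2.2⟩⟩
    ext x
    have : x ∈ Subalgebra.center ℂ A ↔ e x ∈ Subalgebra.center ℂ B3 := by
      simp only [Subalgebra.mem_center_iff]
      constructor
      · intro h b
        obtain ⟨c, rfl⟩ := e.surjective b
        rw [← map_mul, ← map_mul, h]
      · intro h b
        apply e.injective
        rw [map_mul, map_mul, h]
    rw [Subalgebra.mem_toSubmodule, this, hB]
    constructor
    · rintro ⟨y, rfl⟩
      exact ⟨y, by simp⟩
    · rintro ⟨y, hy⟩
      exact ⟨y, by simp [hy]⟩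
  have := LinearMap.finrank_range_of_inj hL
  rw [hr] at this
  simpa using this

/-- For `q` a primitive third root of unity and `(a,b) ≠ (0,0)` in `(ZMod 3)²`, the
center of `A(a,b)` is `3`-dimensional over `ℂ` and `A(a,b)` is isomorphic as a
`ℂ`-algebra to `M₃(ℂ) × M₃(ℂ) × M₃(ℂ)`. -/
theorem stmt10 (q : ℂ) (hq : IsPrimitiveRoot q 3) (a b : ZMod 3)
    (hab : (a, b) ≠ (0, 0)) :
    Module.finrank ℂ (Subalgebra.center ℂ (RingQuot (Rel3 q a b))) = 3 ∧
    Nonempty (RingQuot (Rel3 q a b) ≃ₐ[ℂ]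
      (Matrix (Fin 3) (Fin 3) ℂ × Matrix (Fin 3) (Fin 3) ℂ × Matrix (Fin 3) (Fin 3) ℂ)) := by
  suffices h : Nonempty (RingQuot (Rel3 q a b) ≃ₐ[ℂ] B3) from ⟨center_fr h.some, h⟩
  have hq0 : q ≠ 0 := hq.ne_zero (by norm_num)
  obtain ⟨u, v, w, hu, hv, hw, huv, huw, hvw, hgen⟩ := exists_gens q hq a b hab
  let f : FreeAlgebra ℂ (Fin 3) →ₐ[ℂ] B3 := FreeAlgebra.lift ℂ ![u, v, w]
  have f0 : f (ι ℂ 0) = u := by simp [f]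
  have f1 : f (ι ℂ 1) = v := by simp [f]
  have f2 : f (ι ℂ 2) = w := by simp [f]
  have hf : ∀ ⦃x y⦄, Rel3 q a b x y → f x = f y := by
    intro x y h
    cases h <;> simp only [map_pow, map_mul, map_smul, map_one, f0, f1, f2] <;> assumption
  let π := RingQuot.mkAlgHom ℂ (Rel3 q a b)
  let F : RingQuot (Rel3 q a b) →ₐ[ℂ] B3 := RingQuot.liftAlgHom ℂ ⟨f, hf⟩
  have hF : ∀ x, F (π x) = f x := fun x => RingQuot.liftAlgHom_mkAlgHom_apply ℂ f hf x
  have hsurj : Function.Surjective F := by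
    rw [← AlgHom.range_eq_top, eq_top_iff, ← hgen, Algebra.adjoin_le_iff]
    rintro x (rfl | rfl | rfl)
    · exact ⟨π (ι ℂ 0), (hF _).trans f0⟩
    · exact ⟨π (ι ℂ 1), (hF _).trans f1⟩
    · exact ⟨π (ι ℂ 2), (hF _).trans f2⟩
  have hA : Algebra.adjoin ℂ {π (ι ℂ 0), π (ι ℂ 1), π (ι ℂ 2)} = ⊤ := by
    rw [eq_top_iff]
    rintro x -
    obtain ⟨y, rfl⟩ := RingQuot.mkAlgHom_surjective ℂ (Rel3 q a b) x
    change π y ∈ _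
    induction y using FreeAlgebra.induction with
    | grade0 r => rw [AlgHom.commutes]; exact Subalgebra.algebraMap_mem _ _
    | grade1 i => fin_cases i <;> exact Algebra.subset_adjoin (by simp)
    | mul a b ha hb => rw [map_mul]; exact Subalgebra.mul_mem _ ha hb
    | add a b ha hb => rw [map_add]; exact Subalgebra.add_mem _ ha hb
  have rel : ∀ {x y}, Rel3 q a b x y → π x = π y := fun h => RingQuot.mkAlgHom_rel ℂ h
  have hspan := span_mono (pow_ne_zero a.val hq0) (pow_ne_zero b.val hq0)
    (pow_ne_zero (b - a).val hq0)
    (by simpa only [map_pow, map_one] using rel Rel3.u)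
    (by simpa only [map_pow, map_one] using rel Rel3.v)
    (by simpa only [map_pow, map_one] using rel Rel3.w)
    (by simpa only [map_mul, map_smul] using rel Rel3.uv)
    (by simpa only [map_mul, map_smul] using rel Rel3.uw)
    (by simpa only [map_mul, map_smul] using rel Rel3.vw) hA
  have hfin : Module.Finite ℂ (RingQuot (Rel3 q a b)) :=
    ⟨⟨(Set.finite_range _).toFinset, by rw [Set.Finite.coe_toFinset]; exact hspan⟩⟩
  have hle : Module.finrank ℂ (RingQuot (Rel3 q a b)) ≤ 27 := by
    have := finrank_range_le_card (R := ℂ) (fun t : Fin 3 × Fin 3 × Fin 3 =>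
      π (ι ℂ 0) ^ t.1.val * π (ι ℂ 1) ^ t.2.1.val * π (ι ℂ 2) ^ t.2.2.val)
    rw [Set.finrank, hspan, finrank_top] at this
    simpa using this
  have hB : Module.finrank ℂ B3 = 27 := by simp [Module.finrank_matrix]
  have hbij : Function.Bijective F.toLinearMap :=
    OrzechProperty.bijective_of_surjective_of_finrank_le F.toLinearMap hsurj (by rw [hB]; exact hle)
  exact ⟨AlgEquiv.ofBijective F hbij⟩
end

section
/- Let N ≥ 2 and let q ∈ ℂ be a primitive N-th root of unity. Then the quotient of the free ℂ-algebra on two generators u, v by the two-sided ideal generated by vu − q·uv, u^N − 1, and v^N − 1 is isomorphic as a ℂ-algebra to the full matrix algebra M_N(ℂ) of N×N complex matrices. -/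
open FreeAlgebra

/-- The relations of the algebra of two `q`-commuting unitaries of order `N`:
`vu = q·uv`, `u^N = 1`, `v^N = 1`, where `u, v` are the two generators of the free
`ℂ`-algebra. -/
inductive RelQTorus (q : ℂ) (N : ℕ) :
    FreeAlgebra ℂ (Fin 2) → FreeAlgebra ℂ (Fin 2) → Prop
  | vu : RelQTorus q N (ι ℂ (1 : Fin 2) * ι ℂ (0 : Fin 2))
      (q • (ι ℂ (0 : Fin 2) * ι ℂ (1 : Fin 2)))
  | uN : RelQTorus q N (ι ℂ (0 : Fin 2) ^ N) 1
  | vN : RelQTorus q N (ι ℂ (1 : Fin 2) ^ N) 1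

namespace QT
open Matrix

variable {q : ℂ} {N : ℕ}

noncomputable def mk (q : ℂ) (N : ℕ) : FreeAlgebra ℂ (Fin 2) →ₐ[ℂ] RingQuot (RelQTorus q N) :=
  RingQuot.mkAlgHom ℂ (RelQTorus q N)

noncomputable def u (q : ℂ) (N : ℕ) : RingQuot (RelQTorus q N) := mk q N (ι ℂ 0)
noncomputable def v (q : ℂ) (N : ℕ) : RingQuot (RelQTorus q N) := mk q N (ι ℂ 1)

lemma vu : v q N * u q N = q • (u q N * v q N) := by
  have := RingQuot.mkAlgHom_rel ℂ (RelQTorus.vu (q := q) (N := N))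
  simpa [u, v, mk] using this

lemma uN : u q N ^ N = 1 := by
  have := RingQuot.mkAlgHom_rel ℂ (RelQTorus.uN (q := q) (N := N))
  simpa [u, v, mk] using this

lemma vN : v q N ^ N = 1 := by
  have := RingQuot.mkAlgHom_rel ℂ (RelQTorus.vN (q := q) (N := N))
  simpa [u, v, mk] using this

lemma vu_pow (i : ℕ) : v q N * u q N ^ i = q ^ i • (u q N ^ i * v q N) := by
  induction i with
  | zero => simp
  | succ n ih =>
    rw [pow_succ, ← mul_assoc, ih, smul_mul_assoc, mul_assoc, vu, mul_smul_comm, smul_smul,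
      pow_succ, mul_assoc]

def W (q : ℂ) (N : ℕ) : Submodule ℂ (RingQuot (RelQTorus q N)) :=
  Submodule.span ℂ (Set.range fun p : ℕ × ℕ => u q N ^ p.1 * v q N ^ p.2)

lemma mul_mem_W (x : FreeAlgebra ℂ (Fin 2)) :
    ∀ w ∈ W q N, mk q N x * w ∈ W q N := by
  induction x using FreeAlgebra.induction with
  | grade0 r =>
    intro w hw
    rw [AlgHom.commutes, ← Algebra.smul_def]
    exact Submodule.smul_mem _ _ hw
  | grade1 i =>
    intro w hw
    induction hw using Submodule.span_induction with
    | mem x hx =>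
      obtain ⟨⟨a, b⟩, rfl⟩ := hx
      fin_cases i
      · refine Submodule.subset_span ⟨(a + 1, b), ?_⟩
        simp only [pow_succ', mul_assoc]
        rfl
      · change v q N * (u q N ^ a * v q N ^ b) ∈ _
        rw [← mul_assoc, vu_pow, smul_mul_assoc, mul_assoc, ← pow_succ']
        exact Submodule.smul_mem _ _ (Submodule.subset_span ⟨(a, b + 1), rfl⟩)
    | zero => simp
    | add x y _ _ hx hy => rw [mul_add]; exact add_mem hx hy
    | smul a x _ hx => rw [mul_smul_comm]; exact Submodule.smul_mem _ _ hx
  | mul a b ha hb =>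
    intro w hw
    rw [map_mul, mul_assoc]
    exact ha _ (hb _ hw)
  | add a b ha hb =>
    intro w hw
    rw [map_add, add_mul]
    exact add_mem (ha _ hw) (hb _ hw)

lemma W_top : W q N = ⊤ := by
  rw [eq_top_iff]
  intro x _
  obtain ⟨y, rfl⟩ := RingQuot.mkAlgHom_surjective ℂ (RelQTorus q N) x
  have := mul_mem_W (q := q) (N := N) y 1 (Submodule.subset_span ⟨(0, 0), by simp⟩)
  simpa [mk] using this

lemma span_top (hN : 0 < N) :
    Submodule.span ℂ (Set.range fun p : Fin N × Fin N =>
      u q N ^ (p.1 : ℕ) * v q N ^ (p.2 : ℕ)) = ⊤ := by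
  rw [eq_top_iff, ← W_top, W, Submodule.span_le]
  rintro _ ⟨⟨a, b⟩, rfl⟩
  refine Submodule.subset_span ⟨(⟨a % N, Nat.mod_lt _ hN⟩, ⟨b % N, Nat.mod_lt _ hN⟩), ?_⟩
  simp only
  rw [← pow_eq_pow_mod a uN, ← pow_eq_pow_mod b vN]

def U (N : ℕ) : Matrix (ZMod N) (ZMod N) ℂ :=
  Matrix.of fun a b => if a = b + 1 then 1 else 0

def V (q : ℂ) (N : ℕ) : Matrix (ZMod N) (ZMod N) ℂ := diagonal fun a => q ^ a.val

lemma U_pow [NeZero N] (k : ℕ) :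
    U N ^ k = Matrix.of fun a b => if a = b + (k : ZMod N) then 1 else 0 := by
  induction k with
  | zero => ext a b; simp [Matrix.one_apply]
  | succ n ih =>
    ext a b
    rw [pow_succ, ih, Matrix.mul_apply]
    simp [U, add_assoc, add_comm, add_left_comm]

lemma U_N [NeZero N] : U N ^ N = 1 := by
  rw [U_pow]; ext a b; simp [Matrix.one_apply]

lemma V_N [NeZero N] (hq : IsPrimitiveRoot q N) : V q N ^ N = 1 := by
  rw [V, diagonal_pow, ← diagonal_one]
  congr 1
  ext a
  change (q ^ a.val) ^ N = 1
  rw [← pow_mul, mul_comm, pow_mul, hq.pow_eq_one, one_pow]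

lemma VU [NeZero N] (hN : 2 ≤ N) (hq : IsPrimitiveRoot q N) :
    V q N * U N = q • (U N * V q N) := by
  have : Fact (1 < N) := ⟨hN⟩
  ext a b
  simp only [V, U, diagonal_mul, mul_diagonal, Matrix.smul_apply, of_apply, smul_eq_mul]
  split_ifs with h
  · subst h
    rw [ZMod.val_add, ZMod.val_one, ← pow_eq_pow_mod _ hq.pow_eq_one, pow_succ]
    ring
  · simp

lemma E_eq [NeZero N] (hq : IsPrimitiveRoot q N) (b : ZMod N) :
    ∑ j ∈ Finset.range N, ((q ^ b.val)⁻¹ ^ j) • V q N ^ j = (N : ℂ) • single b b (1 : ℂ) := by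
  have hq0 : q ≠ 0 := hq.ne_zero (NeZero.ne N)
  have h1 : ∀ j : ℕ, ((q ^ b.val)⁻¹ ^ j) • V q N ^ j
      = diagonal fun a : ZMod N => ((q ^ b.val)⁻¹ * q ^ a.val) ^ j := by
    intro j
    rw [V, diagonal_pow, ← diagonal_smul]
    congr 1
    ext a
    simp [mul_pow]
  simp only [h1]
  ext a c
  rw [Matrix.sum_apply]
  by_cases hac : a = c
  · subst hac
    simp only [diagonal_apply_eq, Matrix.smul_apply]
    by_cases hab : b = a
    · subst hab
      simp [hq0]
    · rw [single_apply, if_neg (by tauto)]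
      have hx : (q ^ b.val)⁻¹ * q ^ a.val ≠ 1 := by
        intro h
        apply hab
        have h2 : q ^ b.val = q ^ a.val := by
          field_simp at h
          exact h.symm
        exact ZMod.val_injective N (hq.pow_inj (ZMod.val_lt b) (ZMod.val_lt a) h2)
      rw [geom_sum_eq hx, mul_pow, inv_pow, ← pow_mul, ← pow_mul, mul_comm _ N, mul_comm _ N,
        pow_mul, pow_mul, hq.pow_eq_one]
      simp
  · simp [diagonal_apply_ne _ hac, single_apply]
    intro h1 h2; exact absurd (h1.symm.trans h2) hac

lemma single_eq [NeZero N] (a b : ZMod N) :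
    single a b (1 : ℂ) = U N ^ (a - b).val * single b b (1 : ℂ) := by
  rw [U_pow]
  ext c d
  rw [Matrix.mul_apply]
  simp only [of_apply, single_apply, ZMod.natCast_val, ZMod.cast_id', id_eq, add_sub_cancel]
  by_cases hd : b = d
  · subst hd
    simp [eq_comm]
  · simp [hd]

lemma adjoin_top [NeZero N] (hq : IsPrimitiveRoot q N) (S : Subalgebra ℂ (Matrix (ZMod N) (ZMod N) ℂ))
    (hU : U N ∈ S) (hV : V q N ∈ S) : S = ⊤ := by
  have hb : ∀ b : ZMod N, single b b (1 : ℂ) ∈ S := by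
    intro b
    have h : single b b (1 : ℂ) = (N : ℂ)⁻¹ • ((N : ℂ) • single b b (1 : ℂ)) := by
      rw [inv_smul_smul₀]
      exact_mod_cast NeZero.ne N
    rw [h, ← E_eq hq]
    exact S.smul_mem (S.sum_mem fun j _ => S.smul_mem (S.pow_mem hV _) _) _
  rw [eq_top_iff]
  intro M _
  rw [matrix_eq_sum_single M]
  refine S.sum_mem fun a _ => S.sum_mem fun b _ => ?_
  have : single a b (M a b) = M a b • single a b (1 : ℂ) := by simp
  rw [this, single_eq]
  exact S.smul_mem (S.mul_mem (S.pow_mem hU _) (hb b)) _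

noncomputable def phi [NeZero N] (hN : 2 ≤ N) (hq : IsPrimitiveRoot q N) :
    RingQuot (RelQTorus q N) →ₐ[ℂ] Matrix (ZMod N) (ZMod N) ℂ :=
  RingQuot.liftAlgHom ℂ ⟨FreeAlgebra.lift ℂ ![U N, V q N], by
    rintro _ _ (_ | _ | _)
    · simpa using VU hN hq
    · simpa using U_N
    · simpa using V_N hq⟩

end QT

/-- For `N ≥ 2` and `q` a primitive `N`-th root of unity, the algebra generated by two
`q`-commuting unitaries `u, v` with `u^N = v^N = 1` is isomorphic as a `ℂ`-algebra to the
full matrix algebra `M_N(ℂ)`. -/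
theorem stmt11 (N : ℕ) (hN : 2 ≤ N) (q : ℂ) (hq : IsPrimitiveRoot q N) :
    Nonempty (RingQuot (RelQTorus q N) ≃ₐ[ℂ] Matrix (Fin N) (Fin N) ℂ) := by
  have : NeZero N := ⟨by omega⟩
  have hsurj : Function.Surjective (QT.phi hN hq) := by
    rw [← AlgHom.range_eq_top]
    apply QT.adjoin_top hq
    · exact ⟨QT.u q N, by simp [QT.phi, QT.u, QT.mk]⟩
    · exact ⟨QT.v q N, by simp [QT.phi, QT.v, QT.mk]⟩
  let S := Fintype.linearCombination ℂ (fun p : Fin N × Fin N =>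
      QT.u q N ^ (p.1 : ℕ) * QT.v q N ^ (p.2 : ℕ))
  have hS : Function.Surjective S := by
    rw [← LinearMap.range_eq_top, Fintype.range_linearCombination]
    exact QT.span_top (by omega)
  have hcomp : Function.Injective ((QT.phi hN hq).toLinearMap ∘ₗ S) := by
    rw [LinearMap.injective_iff_surjective_of_finrank_eq_finrank]
    · exact hsurj.comp hS
    · simp [Module.finrank_matrix]
  have hinj : Function.Injective (QT.phi hN hq) := by
    intro x y h
    obtain ⟨c, rfl⟩ := hS x
    obtain ⟨d, rfl⟩ := hS y
    rw [hcomp h]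
  have e : ZMod N ≃ Fin N := Fintype.equivOfCardEq (by simp)
  exact ⟨(AlgEquiv.ofBijective _ ⟨hinj, hsurj⟩).trans (Matrix.reindexAlgEquiv ℂ ℂ e)⟩
end

section
/- Let N ≥ 2 and let q ∈ ℂ be a primitive N-th root of unity. Let T be the quotient of the free ℂ-algebra on three generators u, v, p by the two-sided ideal generated by p² − p, pu − up, pv − vp, vu − (p·uv + q·(1−p)·uv), u^N − 1, and v^N − 1. Then T is a finite-dimensional semisimple ℂ-algebra isomorphic to ℂ^(N²) × M_N(ℂ). -/
open FreeAlgebra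

/-- The relations of the finite quantum double torus algebra `T_q^f`: with generators
`u = ι 0`, `v = ι 1`, `p = ι 2`, they read `p² = p`, `pu = up`, `pv = vp`,
`vu = p·uv + q·(1−p)·uv`, `u^N = 1`, `v^N = 1`. -/
inductive RelDT (q : ℂ) (N : ℕ) :
    FreeAlgebra ℂ (Fin 3) → FreeAlgebra ℂ (Fin 3) → Prop
  | pp : RelDT q N (ι ℂ (2 : Fin 3) * ι ℂ (2 : Fin 3)) (ι ℂ (2 : Fin 3))
  | pu : RelDT q N (ι ℂ (2 : Fin 3) * ι ℂ (0 : Fin 3))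
      (ι ℂ (0 : Fin 3) * ι ℂ (2 : Fin 3))
  | pv : RelDT q N (ι ℂ (2 : Fin 3) * ι ℂ (1 : Fin 3))
      (ι ℂ (1 : Fin 3) * ι ℂ (2 : Fin 3))
  | vu : RelDT q N (ι ℂ (1 : Fin 3) * ι ℂ (0 : Fin 3))
      (ι ℂ (2 : Fin 3) * (ι ℂ (0 : Fin 3) * ι ℂ (1 : Fin 3)) +
        q • ((1 - ι ℂ (2 : Fin 3)) * (ι ℂ (0 : Fin 3) * ι ℂ (1 : Fin 3))))
  | uN : RelDT q N (ι ℂ (0 : Fin 3) ^ N) 1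
  | vN : RelDT q N (ι ℂ (1 : Fin 3) ^ N) 1

section Helpers

theorem dt_span {A : Type*} [Ring A] [Algebra ℂ A] (N : ℕ) (hN : 0 < N) (q : ℂ) (u v p : A)
    (hpp : p * p = p) (hpu : p * u = u * p) (hpv : p * v = v * p)
    (hvu : v * u = p * (u * v) + q • ((1 - p) * (u * v)))
    (huN : u ^ N = 1) (hvN : v ^ N = 1) (hgen : Algebra.adjoin ℂ {u, v, p} = ⊤) :
    Submodule.span ℂ (Set.range (fun x : Fin 2 × Fin N × Fin N =>
      (if x.1 = 0 then p else 1 - p) * u ^ (x.2.1 : ℕ) * v ^ (x.2.2 : ℕ))) = ⊤ := by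
  set b : Fin 2 → A := fun a => if a = 0 then p else 1 - p with hb
  set W := Submodule.span ℂ (Set.range (fun x : Fin 2 × Fin N × Fin N =>
      (if x.1 = 0 then p else 1 - p) * u ^ (x.2.1 : ℕ) * v ^ (x.2.2 : ℕ))) with hW
  have hpui : ∀ i : ℕ, p * u ^ i = u ^ i * p := fun i =>
    (Commute.pow_right (show Commute p u from hpu) i)
  have mem : ∀ (a : Fin 2) (i j : ℕ), b a * u ^ i * v ^ j ∈ W := by
    intro a i j
    rw [pow_eq_pow_mod i huN, pow_eq_pow_mod j hvN]
    exact Submodule.subset_span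
      ⟨(a, ⟨i % N, Nat.mod_lt _ hN⟩, ⟨j % N, Nat.mod_lt _ hN⟩), rfl⟩
  have hub : ∀ a, u * b a = b a * u := by
    intro a; simp only [hb]; split_ifs
    · exact hpu.symm
    · rw [mul_sub, sub_mul, hpu]; simp
  have hvb : ∀ a, v * b a = b a * v := by
    intro a; simp only [hb]; split_ifs
    · exact hpv.symm
    · rw [mul_sub, sub_mul, hpv]; simp
  have hb0 : p * (1 - p) = 0 := by rw [mul_sub, hpp]; simp
  have hb1 : (1 - p) * (1 - p) = 1 - p := by rw [sub_mul, hb0]; simp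
  have hb2 : (1 - p) * p = 0 := by rw [sub_mul, hpp]; simp
  have hvui : ∀ a : Fin 2, ∃ c : ℂ, b a * (v * u) = c • (b a * (u * v)) := by
    intro a
    by_cases h : a = 0
    · refine ⟨1, ?_⟩
      simp only [hb, h, if_true]
      rw [hvu, mul_add, mul_smul_comm, ← mul_assoc, ← mul_assoc p (1 - p), hb0, hpp]; simp
    · refine ⟨q, ?_⟩
      simp only [hb, h, if_false]
      rw [hvu, mul_add, mul_smul_comm, ← mul_assoc, ← mul_assoc (1 - p) (1 - p), hb1, hb2]; simp
  have hvuk : ∀ a : Fin 2, ∀ i : ℕ, ∃ c : ℂ, b a * (v * u ^ i) = c • (b a * (u ^ i * v)) := by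
    intro a i
    induction i with
    | zero => exact ⟨1, by simp⟩
    | succ i ih =>
      obtain ⟨c, hc⟩ := ih
      obtain ⟨d, hd⟩ := hvui a
      refine ⟨c * d, ?_⟩
      have hui : b a * u ^ i = u ^ i * b a :=
        (Commute.pow_right (show Commute (b a) u from (hub a).symm) i)
      calc b a * (v * u ^ (i+1)) = (b a * (v * u ^ i)) * u := by rw [pow_succ]; noncomm_ring
        _ = c • (b a * u ^ i * (v * u)) := by rw [hc, smul_mul_assoc]; noncomm_ring
        _ = c • (u ^ i * (b a * (v * u))) := by rw [hui]; noncomm_ring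
        _ = (c * d) • (u ^ i * b a * (u * v)) := by
            rw [hd, mul_smul_comm, smul_smul]; noncomm_ring
        _ = _ := by rw [← hui, pow_succ]; noncomm_ring
  have key : ∀ x : A, ∀ w ∈ W, x * w ∈ W := by
    intro x
    have hx : x ∈ Algebra.adjoin ℂ {u, v, p} := by rw [hgen]; trivial
    induction hx using Algebra.adjoin_induction with
    | algebraMap r =>
      intro w hw
      rw [← Algebra.smul_def]; exact W.smul_mem r hw
    | add x y _ _ hx hy => intro w hw; rw [add_mul]; exact W.add_mem (hx w hw) (hy w hw)
    | mul x y _ _ hx hy => intro w hw; rw [mul_assoc]; exact hx _ (hy w hw)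
    | mem x hx =>
      intro w hw
      induction hw using Submodule.span_induction with
      | zero => simp
      | add a b _ _ ha hb => rw [mul_add]; exact W.add_mem ha hb
      | smul r a _ ha => rw [mul_smul_comm]; exact W.smul_mem r ha
      | mem w hw =>
        obtain ⟨⟨a, i, j⟩, rfl⟩ := hw
        change x * (b a * u ^ (i : ℕ) * v ^ (j : ℕ)) ∈ W
        rcases hx with rfl | rfl | rfl
        · have : x * (b a * x ^ (i : ℕ) * v ^ (j : ℕ)) = b a * x ^ (i + 1 : ℕ) * v ^ (j : ℕ) := by
            rw [← mul_assoc, ← mul_assoc, hub, pow_succ']; noncomm_ring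
          rw [this]; exact mem _ _ _
        · obtain ⟨c, hc⟩ := hvuk a i
          have : x * (b a * u ^ (i : ℕ) * x ^ (j : ℕ)) =
              c • (b a * u ^ (i : ℕ) * x ^ (j + 1 : ℕ)) := by
            rw [← mul_assoc, ← mul_assoc, hvb, mul_assoc (b a), hc, smul_mul_assoc, pow_succ']
            simp only [mul_assoc]
          rw [this]; exact W.smul_mem _ (mem _ _ _)
        · by_cases h : a = 0
          · have : x * (b a * u ^ (i : ℕ) * v ^ (j : ℕ)) = b a * u ^ (i : ℕ) * v ^ (j : ℕ) := by
              simp only [hb, h, if_true]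
              rw [← mul_assoc, ← mul_assoc, hpp]
            rw [this]; exact mem _ _ _
          · have : x * (b a * u ^ (i : ℕ) * v ^ (j : ℕ)) = 0 := by
              simp only [hb, h, if_false]
              rw [← mul_assoc, ← mul_assoc, hb0]; simp
            rw [this]; exact W.zero_mem
  have h1 : (1 : A) ∈ W := by
    have := W.add_mem (mem 0 0 0) (mem 1 0 0)
    simpa [hb] using this
  rw [eq_top_iff]
  intro x _
  simpa using key x 1 h1

/-- diagonal values -/
noncomputable def dtχ (q : ℂ) (N : ℕ) : Fin N → ℂ := fun i => q ^ (i : ℕ)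

/-- shift matrix -/
noncomputable def dtV (N : ℕ) [NeZero N] : Matrix (Fin N) (Fin N) ℂ :=
  Matrix.of fun i j => if j = i + 1 then 1 else 0

theorem dtV_pow (N : ℕ) [NeZero N] (k : ℕ) (i j : Fin N) :
    (dtV N ^ k) i j = if j = i + Fin.ofNat N k then 1 else 0 := by
  induction k generalizing i j with
  | zero =>
    have : Fin.ofNat N 0 = 0 := by ext; simp
    simp [Matrix.one_apply, this, eq_comm]
  | succ k ih =>
    have : Fin.ofNat N (k+1) = Fin.ofNat N k + 1 := by
      ext; simp [Fin.val_add]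
    rw [pow_succ, Matrix.mul_apply, this]
    simp only [ih]
    rw [Finset.sum_eq_single (i + Fin.ofNat N k)]
    · simp only [dtV, Matrix.of_apply, if_true, one_mul, add_assoc]
    · intro x _ hx; rw [if_neg hx, zero_mul]
    · simp

theorem dtχ_succ (q : ℂ) (N : ℕ) [NeZero N] (hq : q ^ N = 1) (i : Fin N) :
    dtχ q N (i + 1) = q * dtχ q N i := by
  simp only [dtχ]
  rw [← pow_succ', Fin.val_add, ← pow_eq_pow_mod _ hq, pow_add, pow_succ]
  congr 1
  rw [Fin.val_one', ← pow_eq_pow_mod _ hq, pow_one]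

abbrev DTtgt (N : ℕ) := (Fin N × Fin N → ℂ) × Matrix (Fin N) (Fin N) ℂ

noncomputable def dtGen (q : ℂ) (N : ℕ) [NeZero N] : Fin 3 → DTtgt N :=
  ![(fun x => dtχ q N x.1, Matrix.diagonal (dtχ q N)), (fun x => dtχ q N x.2, dtV N), (1, 0)]

theorem dtχ_pow (q : ℂ) (N : ℕ) (hq : q ^ N = 1) (i : Fin N) : dtχ q N i ^ N = 1 := by
  rw [dtχ, ← pow_mul, mul_comm, pow_mul, hq, one_pow]

theorem dtRel (q : ℂ) (N : ℕ) [NeZero N] (hq : q ^ N = 1) ⦃x y : FreeAlgebra ℂ (Fin 3)⦄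
    (h : RelDT q N x y) :
    FreeAlgebra.lift ℂ (dtGen q N) x = FreeAlgebra.lift ℂ (dtGen q N) y := by
  cases h with
  | pp => simp [dtGen]
  | pu => simp [dtGen]
  | pv => simp [dtGen]
  | vu =>
    simp only [map_mul, map_add, map_sub, map_smul, map_one, FreeAlgebra.lift_ι_apply]
    simp only [dtGen]
    refine Prod.ext ?_ ?_
    · ext x; simp [mul_comm]
    · ext i j
      by_cases h : j = i + 1 <;> simp [dtV, h, dtχ_succ q N hq]
  | uN =>
    simp only [map_pow, map_one, FreeAlgebra.lift_ι_apply]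
    refine Prod.ext ?_ ?_
    · ext x; simp [dtGen, dtχ_pow q N hq]
    · have : dtχ q N ^ N = 1 := by ext i; simp [dtχ_pow q N hq]
      simp [dtGen, Matrix.diagonal_pow, this]
  | vN =>
    simp only [map_pow, map_one, FreeAlgebra.lift_ι_apply]
    refine Prod.ext ?_ ?_
    · ext x; simp [dtGen, dtχ_pow q N hq]
    · ext i j
      have : Fin.ofNat N N = 0 := by ext; simp
      simp [dtGen, dtV_pow, this, Matrix.one_apply, eq_comm]

theorem dt_surj (q : ℂ) (N : ℕ) [NeZero N] (hq : IsPrimitiveRoot q N)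
    (R : Subalgebra ℂ (DTtgt N)) (hR : ∀ i, dtGen q N i ∈ R) : R = ⊤ := by
  have inj : Set.InjOn (dtχ q N) (Finset.univ : Finset (Fin N)) := by
    intro i _ j _ h
    exact Fin.ext (hq.pow_inj i.2 j.2 h)
  set L : Fin N → Polynomial ℂ := fun a => Lagrange.basis Finset.univ (dtχ q N) a with hL
  have hLe : ∀ a b, (L a).eval (dtχ q N b) = if b = a then 1 else 0 := by
    intro a b
    split_ifs with h
    · rw [h]; exact Lagrange.eval_basis_self inj (Finset.mem_univ _)
    · exact Lagrange.eval_basis_of_ne (Ne.symm h) (Finset.mem_univ _)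
  have hae : ∀ x ∈ R, ∀ P : Polynomial ℂ, Polynomial.aeval x P ∈ R := fun x hx P =>
    Polynomial.aeval_mem_adjoin_singleton ℂ x |> fun h =>
      (Algebra.adjoin_le (Set.singleton_subset_iff.2 hx)) h
  have hfst : ∀ (x : DTtgt N) (P : Polynomial ℂ) (c : Fin N × Fin N),
      (Polynomial.aeval x P).1 c = P.eval (x.1 c) := by
    intro x P c
    have := Polynomial.aeval_algHom_apply
      ((Pi.evalAlgHom ℂ (fun _ : Fin N × Fin N => ℂ) c).comp
        (AlgHom.fst ℂ (Fin N × Fin N → ℂ) (Matrix (Fin N) (Fin N) ℂ))) x P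
    simpa [Polynomial.coe_aeval_eq_eval] using this.symm
  have hsnd : ∀ (a : Fin N), (Polynomial.aeval (dtGen q N 0) (L a)).2 =
      Matrix.diagonal (fun b => if b = a then 1 else 0) := by
    intro a
    have h1 := Polynomial.aeval_algHom_apply
        (AlgHom.snd ℂ (Fin N × Fin N → ℂ) (Matrix (Fin N) (Fin N) ℂ)) (dtGen q N 0) (L a)
    have h2 := Polynomial.aeval_algHom_apply
        (Matrix.diagonalAlgHom (n := Fin N) (α := ℂ) ℂ) (dtχ q N) (L a)
    have h3 : Polynomial.aeval (dtχ q N) (L a) = fun b => if b = a then (1:ℂ) else 0 := by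
      ext b
      have := Polynomial.aeval_algHom_apply
        (Pi.evalAlgHom ℂ (fun _ : Fin N => ℂ) b) (dtχ q N) (L a)
      rw [← hLe a b]
      simpa [Polynomial.coe_aeval_eq_eval] using this.symm
    rw [h3] at h2
    exact h1.symm.trans h2
  have e1 : ∀ a b : Fin N, ((Pi.single (a, b) 1, 0) : DTtgt N) ∈ R := by
    intro a b
    have : ((Pi.single (a, b) 1, 0) : DTtgt N) = dtGen q N 2 *
        Polynomial.aeval (dtGen q N 0) (L a) * Polynomial.aeval (dtGen q N 1) (L b) := by
      refine Prod.ext ?_ ?_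
      · ext ⟨c, d⟩
        simp only [Prod.fst_mul, Pi.mul_apply, hfst]
        simp only [dtGen]
        by_cases h1 : c = a <;> by_cases h2 : d = b <;> simp [hLe, h1, h2, Pi.single_apply]
      · simp [dtGen]
    rw [this]
    exact R.mul_mem (R.mul_mem (hR 2) (hae _ (hR 0) _)) (hae _ (hR 1) _)
  have e2 : ∀ i j : Fin N, ((0, Matrix.single i j 1) : DTtgt N) ∈ R := by
    intro i j
    have : ((0, Matrix.single i j 1) : DTtgt N) = (1 - dtGen q N 2) *
        Polynomial.aeval (dtGen q N 0) (L i) * dtGen q N 1 ^ ((j - i : Fin N) : ℕ) := by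
      refine Prod.ext ?_ ?_
      · simp [dtGen]
      · rw [Prod.snd_mul, Prod.snd_mul, hsnd]
        ext a b
        have : (dtGen q N 1 ^ ((j - i : Fin N) : ℕ)).2 = dtV N ^ ((j - i : Fin N) : ℕ) := rfl
        rw [this]
        have : (1 - dtGen q N 2).2 = 1 := by simp [dtGen]
        rw [this, one_mul, Matrix.diagonal_mul, dtV_pow]
        by_cases h : a = i
        · subst h
          simp [Matrix.single_apply, eq_comm]
        · simp [Matrix.single_apply, h, Ne.symm h]
    rw [this]
    exact R.mul_mem (R.mul_mem (R.sub_mem R.one_mem (hR 2)) (hae _ (hR 0) _)) (R.pow_mem (hR 1) _)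
  rw [eq_top_iff]
  rintro ⟨f, M⟩ _
  have : ((f, M) : DTtgt N) = (∑ x : Fin N × Fin N, f x • ((Pi.single (x.1, x.2) 1, 0) : DTtgt N))
      + ∑ i, ∑ j, M i j • ((0, Matrix.single i j 1) : DTtgt N) := by
    refine Prod.ext ?_ ?_
    · ext c
      simp [Prod.fst_sum, Finset.sum_apply, Pi.single_apply]
    · simp only [Prod.snd_add, Prod.snd_sum, Prod.smul_snd, smul_zero, Finset.sum_const_zero, zero_add]
      conv_lhs => rw [Matrix.matrix_eq_sum_single M]
      simp [Matrix.smul_single]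
  rw [this]
  exact R.add_mem (R.sum_mem fun x _ => R.smul_mem (e1 _ _) _)
    (R.sum_mem fun i _ => R.sum_mem fun j _ => R.smul_mem (e2 _ _) _)

end Helpers

/-- For `N ≥ 2` and `q` a primitive `N`-th root of unity, the algebra `T = T_q^f` is a
finite-dimensional semisimple `ℂ`-algebra isomorphic to `ℂ^(N²) × M_N(ℂ)`. -/
theorem stmt12 (N : ℕ) (hN : 2 ≤ N) (q : ℂ) (hq : IsPrimitiveRoot q N) :
    FiniteDimensional ℂ (RingQuot (RelDT q N)) ∧
    IsSemisimpleRing (RingQuot (RelDT q N)) ∧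
    Nonempty (RingQuot (RelDT q N) ≃ₐ[ℂ]
      ((Fin (N ^ 2) → ℂ) × Matrix (Fin N) (Fin N) ℂ)) := by
  have hN0 : 0 < N := by omega
  haveI : NeZero N := ⟨hN0.ne'⟩
  have hq1 := hq.pow_eq_one
  let π := RingQuot.mkAlgHom ℂ (RelDT q N)
  have hπ : Function.Surjective π := RingQuot.mkAlgHom_surjective ℂ (RelDT q N)
  have rel : ∀ {x y}, RelDT q N x y → π x = π y := fun h => RingQuot.mkAlgHom_rel ℂ h
  have hgen : Algebra.adjoin ℂ {π (ι ℂ 0), π (ι ℂ 1), π (ι ℂ 2)} = ⊤ := by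
    have h1 : ({π (ι ℂ 0), π (ι ℂ 1), π (ι ℂ 2)} : Set (RingQuot (RelDT q N))) =
        π '' Set.range (ι ℂ : Fin 3 → FreeAlgebra ℂ (Fin 3)) := by
      ext x
      simp [Fin.exists_fin_succ, eq_comm]
    rw [h1, ← AlgHom.map_adjoin, FreeAlgebra.adjoin_range_ι, Algebra.map_top]
    exact (AlgHom.range_eq_top π).2 hπ
  have hspan := dt_span N hN0 q (π (ι ℂ 0)) (π (ι ℂ 1)) (π (ι ℂ 2))
    (by simpa using rel (RelDT.pp)) (by simpa using rel (RelDT.pu))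
    (by simpa using rel (RelDT.pv)) (by simpa using rel (RelDT.vu))
    (by simpa using rel (RelDT.uN)) (by simpa using rel (RelDT.vN)) hgen
  have hfin : FiniteDimensional ℂ (RingQuot (RelDT q N)) :=
    ⟨Submodule.fg_def.2 ⟨_, Set.finite_range _, hspan⟩⟩
  have hle : Module.finrank ℂ (RingQuot (RelDT q N)) ≤ 2 * (N * N) := by
    have := finrank_range_le_card (R := ℂ) (fun x : Fin 2 × Fin N × Fin N =>
      (if x.1 = 0 then π (ι ℂ 2) else 1 - π (ι ℂ 2)) * π (ι ℂ 0) ^ (x.2.1 : ℕ)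
        * π (ι ℂ 1) ^ (x.2.2 : ℕ))
    rw [Set.finrank, hspan, finrank_top] at this
    simpa using this
  let φ : RingQuot (RelDT q N) →ₐ[ℂ] DTtgt N :=
    RingQuot.liftAlgHom ℂ ⟨FreeAlgebra.lift ℂ (dtGen q N), dtRel q N hq1⟩
  have hφs : Function.Surjective φ := by
    rw [← AlgHom.range_eq_top]
    refine dt_surj q N hq _ fun i => ⟨π (ι ℂ i), ?_⟩
    simp [φ, π]
  have hdim : Module.finrank ℂ (RingQuot (RelDT q N)) = Module.finrank ℂ (DTtgt N) := by
    refine le_antisymm (hle.trans (le_of_eq ?_))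
      (LinearMap.finrank_le_finrank_of_surjective (f := φ.toLinearMap) hφs)
    simp [Module.finrank_prod, Module.finrank_matrix]
    ring
  have hφi : Function.Injective φ :=
    (LinearMap.injective_iff_surjective_of_finrank_eq_finrank (f := φ.toLinearMap) hdim).2 hφs
  let e1 := AlgEquiv.ofBijective φ ⟨hφi, hφs⟩
  let σ : Fin (N ^ 2) ≃ Fin N × Fin N := Fintype.equivOfCardEq (by simp [sq])
  let e2 : (Fin N × Fin N → ℂ) ≃ₐ[ℂ] (Fin (N ^ 2) → ℂ) := 
    (AlgEquiv.piCongrLeft ℂ (fun _ : Fin N × Fin N => ℂ) σ).symm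
  let e := e1.trans (AlgEquiv.prodCongr e2 AlgEquiv.refl)
  exact ⟨hfin, e.symm.toRingEquiv.isSemisimpleRing, ⟨e⟩⟩
end

section
/- Let N ≥ 1 and let p be a polynomial in two variables over ℂ (an element of MvPolynomial (Fin 2) ℂ). If p(x,y) = 0 for every pair x,y ∈ ℂ with x^N = 1 and y^N = 1, then p lies in the ideal of the polynomial ring generated by X^N − 1 and Y^N − 1, i.e., p = (X^N − 1)·p₁ + (Y^N − 1)·p₂ for some polynomials p₁, p₂. -/
open MvPolynomial

lemma prod_nthRoots_aux (N : ℕ) (hN : 1 ≤ N) (i : Fin 2) :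
    ∏ r ∈ Polynomial.nthRootsFinset N (1 : ℂ), (X i - C r : MvPolynomial (Fin 2) ℂ)
      = X i ^ N - 1 := by
  have h := Polynomial.X_pow_sub_one_eq_prod (R := ℂ) hN
    (Complex.isPrimitiveRoot_exp N (by omega))
  have h2 := congrArg (Polynomial.aeval (X i : MvPolynomial (Fin 2) ℂ)) h
  simp only [map_sub, map_pow, map_prod, map_one, Polynomial.aeval_X, Polynomial.aeval_C] at h2
  rw [h2]
  rfl

/-- If a complex polynomial `p(X,Y)` vanishes at every pair `(x,y)` of `N`-th roots of
unity, then `p` lies in the ideal generated by `X^N − 1` and `Y^N − 1`, i.e.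
`p = (X^N − 1)·p₁ + (Y^N − 1)·p₂` for some polynomials `p₁, p₂`. -/
theorem stmt13 (N : ℕ) (hN : 1 ≤ N) (p : MvPolynomial (Fin 2) ℂ)
    (hvan : ∀ x y : ℂ, x ^ N = 1 → y ^ N = 1 → eval ![x, y] p = 0) :
    p ∈ Ideal.span ({X 0 ^ N - 1, X 1 ^ N - 1} : Set (MvPolynomial (Fin 2) ℂ)) ∧
    ∃ p₁ p₂ : MvPolynomial (Fin 2) ℂ,
      p = (X 0 ^ N - 1) * p₁ + (X 1 ^ N - 1) * p₂ := by
  have key : ∃ p₁ p₂ : MvPolynomial (Fin 2) ℂ,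
      p = (X 0 ^ N - 1) * p₁ + (X 1 ^ N - 1) * p₂ := by
    obtain ⟨h, -, hf⟩ := combinatorial_nullstellensatz_exists_linearCombination
      (fun _ : Fin 2 => Polynomial.nthRootsFinset N (1 : ℂ))
      (fun _ => ⟨1, by rw [Polynomial.mem_nthRootsFinset hN]; simp⟩) p (by
        intro x hx
        have e : x = ![x 0, x 1] := by
          ext i; fin_cases i <;> rfl
        rw [e]
        exact hvan _ _ ((Polynomial.mem_nthRootsFinset hN _).1 (hx 0))
          ((Polynomial.mem_nthRootsFinset hN _).1 (hx 1)))
    refine ⟨h 0, h 1, ?_⟩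
    rw [Finsupp.linearCombination_apply, Finsupp.sum_fintype _ _ (by simp), Fin.sum_univ_two] at hf
    simp only [prod_nthRoots_aux N hN, smul_eq_mul] at hf
    rw [mul_comm _ (h 0), mul_comm _ (h 1)]
    exact hf
  refine ⟨?_, key⟩
  obtain ⟨a, b, hab⟩ := key
  rw [Ideal.mem_span_pair]
  exact ⟨a, b, by rw [hab]; ring⟩
end

section
/- Let N ≥ 1 and let W be the free ℂ-module with basis {w₊^(ij), w₋^(ij) : i,j ∈ ZMod N}, equipped with the ℂ-bilinear multiplication determined on basis elements by: w₊^(kl)·w₊^(mn) = δ_{km}δ_{ln}·w₊^(mn), w₊^(kl)·w₋^(mn) = δ_{kn}δ_{lm}·w₋^(mn), w₋^(kl)·w₊^(mn) = δ_{km}δ_{ln}·w₋^(mn), w₋^(kl)·w₋^(mn) = δ_{kn}δ_{lm}·w₊^(mn). Then this multiplication is associative and unital (with unit Σ_{k,l} w₊^(kl)), and W is isomorphic as a ℂ-algebra to the product of N(N−1)/2 copies of M₂(ℂ) with 2N copies of ℂ; in particular dim_ℂ W = 2N². -/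
/-- The underlying free `ℂ`-module of the dual Kac-Paljutkin algebra `W`, with basis
indexed by a sign (`true` = `+`, `false` = `−`) and a pair `(i,j)` of indices in
`ZMod N`. -/
abbrev W15 (N : ℕ) : Type := Bool × ZMod N × ZMod N → ℂ

/-- The basis element `w_s^(ij)` of `W` (`s = true` for `w₊`, `s = false` for `w₋`). -/
noncomputable def wBasis {N : ℕ} (s : Bool) (i j : ZMod N) : W15 N :=
  Pi.single (s, i, j) 1

/-- The `ℂ`-bilinear multiplication on `W` determined on basis elements by
`w₊^(kl)·w₊^(mn) = δ_{km}δ_{ln}·w₊^(mn)`, `w₊^(kl)·w₋^(mn) = δ_{kn}δ_{lm}·w₋^(mn)`,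
`w₋^(kl)·w₊^(mn) = δ_{km}δ_{ln}·w₋^(mn)`, `w₋^(kl)·w₋^(mn) = δ_{kn}δ_{lm}·w₊^(mn)`. -/
noncomputable def wMul {N : ℕ} (f g : W15 N) : W15 N :=
  fun x => f (x.1, x.2.1, x.2.2) * g (true, x.2.1, x.2.2) +
    f (!x.1, x.2.2, x.2.1) * g (false, x.2.1, x.2.2)

/-- The element `Σ_{k,l} w₊^(kl)` of `W`. -/
noncomputable def wOne {N : ℕ} : W15 N := fun x => if x.1 = true then 1 else 0

abbrev P15 (N : ℕ) : Type := {p : ZMod N × ZMod N // p.1.val < p.2.val}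

noncomputable def phi15 (N : ℕ) [NeZero N] :
    W15 N ≃ₗ[ℂ] ((P15 N → Matrix (Fin 2) (Fin 2) ℂ) × (Bool × ZMod N → ℂ)) where
  toFun f := (fun p => !![f (true, p.1.1, p.1.2), f (false, p.1.2, p.1.1);
      f (false, p.1.1, p.1.2), f (true, p.1.2, p.1.1)],
    fun q => f (true, q.2, q.2) + (if q.1 = true then 1 else -1) * f (false, q.2, q.2))
  map_add' f g := by
    refine Prod.ext ?_ ?_
    · funext p; ext a b; fin_cases a <;> fin_cases b <;> simp
    · funext q; simp only [Pi.add_apply, Prod.snd_add]; ring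
  map_smul' c f := by
    refine Prod.ext ?_ ?_
    · funext p; ext a b; fin_cases a <;> fin_cases b <;> simp
    · funext q; simp only [Pi.smul_apply, Prod.smul_snd, smul_eq_mul, RingHom.id_apply]; ring
  invFun M x :=
    if h : x.2.1.val < x.2.2.val then
      (if x.1 = true then M.1 ⟨(x.2.1, x.2.2), h⟩ 0 0 else M.1 ⟨(x.2.1, x.2.2), h⟩ 1 0)
    else if h : x.2.2.val < x.2.1.val then
      (if x.1 = true then M.1 ⟨(x.2.2, x.2.1), h⟩ 1 1 else M.1 ⟨(x.2.2, x.2.1), h⟩ 0 1)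
    else (M.2 (true, x.2.1) + (if x.1 = true then 1 else -1) * M.2 (false, x.2.1)) / 2
  left_inv f := by
    funext ⟨s, i, j⟩
    by_cases h : i.val < j.val
    · cases s <;> simp [h]
    · by_cases h' : j.val < i.val
      · cases s <;> simp [h, h']
      · have : i = j := ZMod.val_injective N (by omega)
        subst this
        cases s <;> simp <;> ring
  right_inv M := by
    refine Prod.ext ?_ ?_
    · funext ⟨⟨i, j⟩, h⟩
      have h1 : i.val < j.val := h
      have h2 : ¬ j.val < i.val := by omega
      ext a b; fin_cases a <;> fin_cases b <;> simp [h1, h2]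
    · funext ⟨s, i⟩
      cases s <;> simp <;> ring

theorem phi15_mul (N : ℕ) [NeZero N] (f g : W15 N) :
    phi15 N (wMul f g) = phi15 N f * phi15 N g := by
  refine Prod.ext ?_ ?_
  · funext p; ext a b
    fin_cases a <;> fin_cases b <;> simp [phi15, wMul, Matrix.mul_apply, Fin.sum_univ_two] <;> ring
  · funext ⟨s, i⟩
    cases s <;> simp [phi15, wMul] <;> ring

theorem phi15_one (N : ℕ) [NeZero N] : phi15 N wOne = 1 := by
  refine Prod.ext ?_ ?_
  · funext p; ext a b
    fin_cases a <;> fin_cases b <;> simp [phi15, wOne]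
  · funext ⟨s, i⟩
    cases s <;> simp [phi15, wOne]

theorem finrank15 (N : ℕ) [NeZero N] : Module.finrank ℂ (W15 N) = 2 * N ^ 2 := by
  simp [ZMod.card]; ring

theorem card15 (N : ℕ) [NeZero N] : Fintype.card (P15 N) = N * (N - 1) / 2 := by
  have h := (phi15 N).finrank_eq
  rw [finrank15, Module.finrank_prod, Module.finrank_pi_fintype] at h
  simp [ZMod.card, Module.finrank_matrix] at h
  obtain ⟨n, rfl⟩ : ∃ n, N = n + 1 := ⟨N - 1, by have := NeZero.pos N; omega⟩
  simp only [Nat.add_sub_cancel]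
  have : (n + 1) * n = 2 * Fintype.card (P15 (n + 1)) := by
    nlinarith
  omega

/-- The multiplication on `W` satisfies the stated rules on basis elements, is
associative and unital with unit `Σ_{k,l} w₊^(kl)`, and `W` is isomorphic as a
`ℂ`-algebra to the product of `N(N−1)/2` copies of `M₂(ℂ)` and `2N` copies of `ℂ`;
in particular `dim_ℂ W = 2N²`. -/
theorem stmt15 (N : ℕ) [NeZero N] (hN : 1 ≤ N) :
    (∀ k l m n : ZMod N,
        wMul (wBasis true k l) (wBasis true m n) =
          (if k = m ∧ l = n then (1 : ℂ) else 0) • wBasis true m n ∧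
        wMul (wBasis true k l) (wBasis false m n) =
          (if k = n ∧ l = m then (1 : ℂ) else 0) • wBasis false m n ∧
        wMul (wBasis false k l) (wBasis true m n) =
          (if k = m ∧ l = n then (1 : ℂ) else 0) • wBasis false m n ∧
        wMul (wBasis false k l) (wBasis false m n) =
          (if k = n ∧ l = m then (1 : ℂ) else 0) • wBasis true m n) ∧
    (∀ f g h : W15 N, wMul (wMul f g) h = wMul f (wMul g h)) ∧
    (∀ f : W15 N, wMul wOne f = f ∧ wMul f wOne = f) ∧
    (wOne = ∑ k : ZMod N, ∑ l : ZMod N, wBasis true k l) ∧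
    (∃ φ : W15 N ≃ₗ[ℂ]
        ((Fin (N * (N - 1) / 2) → Matrix (Fin 2) (Fin 2) ℂ) × (Fin (2 * N) → ℂ)),
      (∀ f g : W15 N, φ (wMul f g) = φ f * φ g) ∧ φ wOne = 1) ∧
    Module.finrank ℂ (W15 N) = 2 * N ^ 2 := by
  refine ⟨?_, ?_, ?_, ?_, ?_, finrank15 N⟩
  · intro k l m n
    refine ⟨?_, ?_, ?_, ?_⟩ <;>
    · funext ⟨s, i, j⟩
      cases s <;> simp [wMul, wBasis, Pi.single_apply] <;> grind
  · intro f g h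
    funext ⟨s, i, j⟩
    cases s <;> simp [wMul] <;> ring
  · intro f
    constructor <;>
    · funext ⟨s, i, j⟩
      cases s <;> simp [wMul, wOne]
  · funext ⟨s, i, j⟩
    cases s
    · simp [wOne, wBasis, Finset.sum_apply, Pi.single_apply]
    · simp [wOne, wBasis, Finset.sum_apply, Pi.single_apply, ite_and]
  · have e1 : Fin (N * (N - 1) / 2) ≃ P15 N :=
      (Fintype.equivFinOfCardEq (card15 N)).symm
    have e2 : Fin (2 * N) ≃ Bool × ZMod N :=
      (Fintype.equivFinOfCardEq (by simp [ZMod.card])).symm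
    refine ⟨(phi15 N).trans (LinearEquiv.prodCongr (LinearEquiv.funCongrLeft ℂ _ e1)
      (LinearEquiv.funCongrLeft ℂ _ e2)), ?_, ?_⟩
    · intro f g
      simp only [LinearEquiv.trans_apply, phi15_mul]
      rfl
    · simp only [LinearEquiv.trans_apply, phi15_one]
      rfl
end
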